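/- arXiv:1109.1691 — 15 statements merged into one kernel-verified Lean document; each statement's English description precedes it below -/
import Mathlib

section
/- For all words y, z, s, t over an alphabet Γ: if yz ⊑ st and z ⊑ t, and x is the longest prefix of t such that z is a subword of the word obtained from t by removing the prefix x, then y ⊑ sx. -/
open List

/-- Subwords and concatenation, item 4: if yz ⊑ st and z ⊑ t, and x is the
longest prefix of t such that z embeds in the rest of t, then y ⊑ sx. -/
theorem subword_concat_longest_prefix {Γ : Type*} (y z s t x w : List Γ)
    (h : (y ++ z) <+ (s ++ t)) (hzt : z <+ t)
    (htx : t = x ++ w) (hzw : z <+ w)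
    (hlongest : ∀ x' w' : List Γ, t = x' ++ w' → z <+ w' → x'.length ≤ x.length) :
    y <+ (s ++ x) := by
  subst htx
  rw [← List.append_assoc] at h
  obtain ⟨r₁, r₂, hr, hy, hz⟩ := List.append_sublist_iff.mp h
  rcases List.append_eq_append_iff.mp hr with ⟨a, rfl, rfl⟩ | ⟨a, ha, -⟩
  · have hlen := hlongest (x ++ a) r₂ (by simp) hz
    have ha : a = [] := by
      rw [← List.length_eq_zero_iff]
      simp only [List.length_append] at hlen
      omega
    simpa [ha] using hy
  · rw [ha]
    exact hy.trans (List.sublist_append_left r₁ a)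
end

section
/- For all words y, z, s, t over an alphabet Γ: if yz ⊑ st and z ̸⊑ t, and x is the shortest suffix of s such that z ⊑ xt (such a suffix exists since z ⊑ st), then y is a subword of the word obtained from s by removing the suffix x, i.e., writing s = s'x, one has y ⊑ s'. -/
open List

/-- Subwords and concatenation, item 5: if yz ⊑ st and z ̸⊑ t, and x is the
shortest suffix of s such that z ⊑ xt, then, writing s = s'x, one has y ⊑ s'. -/
theorem subword_concat_shortest_suffix {Γ : Type*} (y z s t x s' : List Γ)
    (h : (y ++ z) <+ (s ++ t)) (hzt : ¬ z <+ t)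
    (hs : s = s' ++ x) (hzx : z <+ (x ++ t))
    (hshortest : ∀ x' : List Γ, x' <:+ s → z <+ (x' ++ t) → x.length ≤ x'.length) :
    y <+ s' := by
  subst hs
  obtain ⟨u, v, huv, hyu, hzv⟩ := append_sublist_iff.1 h
  rw [append_assoc] at huv
  rcases append_eq_append_iff.1 huv with ⟨a, rfl, hxt⟩ | ⟨c, rfl, -⟩
  · rcases append_eq_append_iff.1 hxt with ⟨c, rfl, rfl⟩ | ⟨c, rfl, rfl⟩
    · exact absurd (hzv.trans (sublist_append_right c v)) hzt
    · have hlen := hshortest c ⟨s' ++ a, by simp⟩ hzv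
      have ha : a = [] := by
        rw [← length_eq_zero_iff]
        rw [length_append] at hlen
        omega
      simpa [ha] using hyu
  · exact hyu.trans (sublist_append_left u c)
end

section
/- For all words x, y, s, t over an alphabet Γ: if sx ⊑ yt and t ⊑ s, then s·x^k ⊑ y^k·t for all k ≥ 1 (where w^k denotes the k-fold concatenation of w with itself). -/
open List

/-- Subwords and concatenation, item 6: if sx ⊑ yt and t ⊑ s, then
s·x^k ⊑ y^k·t for all k ≥ 1. -/
theorem subword_pump_right {Γ : Type*} (x y s t : List Γ)
    (h : (s ++ x) <+ (y ++ t)) (hts : t <+ s) :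
    ∀ k : ℕ, 1 ≤ k →
      (s ++ (List.replicate k x).flatten) <+ ((List.replicate k y).flatten ++ t) := by
  intro k hk
  induction k, hk using Nat.le_induction with
  | base => simpa using h
  | succ k _ ih =>
    simp only [List.replicate_succ, List.flatten_cons, List.append_assoc]
    rw [← List.append_assoc]
    refine (h.append_right _).trans ?_
    rw [List.append_assoc]
    exact ((hts.append_right _).trans ih).append_left y
end

section
/- For all words x, y, s, t over an alphabet Γ: if xs ⊑ ty and t ⊑ s, then x^k·s ⊑ t·y^k for all k ≥ 1 (where w^k denotes the k-fold concatenation of w with itself). -/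
open List

/-- Subwords and concatenation, item 7: if xs ⊑ ty and t ⊑ s, then
x^k·s ⊑ t·y^k for all k ≥ 1. -/
theorem subword_pump_left {Γ : Type*} (x y s t : List Γ)
    (h : (x ++ s) <+ (t ++ y)) (hts : t <+ s) :
    ∀ k : ℕ, 1 ≤ k →
      ((List.replicate k x).flatten ++ s) <+ (t ++ (List.replicate k y).flatten) := by
  intro k hk
  induction k, hk using Nat.le_induction with
  | base => simpa using h
  | succ k _ ih =>
    have h₁ : (replicate k x).flatten ++ (x ++ s) <+ (replicate k x).flatten ++ (s ++ y) :=
      (h.trans (hts.append_right y)).append_left _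
    have h₂ : (replicate k x).flatten ++ s ++ y <+ t ++ (replicate k y).flatten ++ y :=
      ih.append_right y
    rw [replicate_succ' (n := k) (a := x), replicate_succ' (n := k) (a := y)]
    simpa using h₁.trans (by simpa using h₂)
end

section
/- Let Γ be a finite alphabet and let n, k ∈ ℕ. Then there exists L ∈ ℕ such that every sequence x_1, x_2, …, x_l of words over Γ that is k-controlled (i.e., |x_i| ≤ i·k for all i = 1, …, l) and n-bad (i.e., there are no indices i_1 < i_2 < … < i_n with x_{i_1} ⊑ x_{i_2} ⊑ … ⊑ x_{i_n}) has length l ≤ L. -/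
open List

/-- **Higman's lemma** for words over a finite alphabet: every infinite sequence of words has an
infinite subsequence that is increasing with respect to the subword order. -/
theorem exists_sublist_monotone_subseq {Γ : Type*} [Finite Γ] (y : ℕ → List Γ) :
    ∃ g : ℕ ↪o ℕ, ∀ i j : ℕ, i ≤ j → (y (g i)) <+ (y (g j)) := by
  have : IsPreorder Γ (· = ·) := { refl := fun _ ↦ rfl, trans := fun _ _ _ ↦ Eq.trans }
  have hpwo := Set.PartiallyWellOrderedOn.partiallyWellOrderedOn_sublistForall₂ (· = ·)
    (Set.toFinite (Set.univ : Set Γ)).partiallyWellOrderedOn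
  have : IsPreorder (List Γ) (SublistForall₂ (· = ·)) := {}
  obtain ⟨g, hg⟩ := hpwo.exists_monotone_subseq (f := y) fun _ _ _ ↦ Set.mem_univ _
  refine ⟨g, fun i j hij ↦ ?_⟩
  obtain ⟨l, hl, hsub⟩ := List.sublistForall₂_iff.1 (hg i j hij)
  rw [List.forall₂_eq_eq_eq] at hl
  exact hl ▸ hsub

/-- Compactness: if arbitrarily long finite sequences have their `i`-th terms in the finite sets
`S i`, then some infinite sequence agrees with arbitrarily long ones on every initial segment. -/
theorem exists_seq_forall_frequently_agree {α : Type*} {S : ℕ → Set α} (hS : ∀ i, (S i).Finite)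
    {l : ℕ → ℕ} (hl : ∀ N, N < l N) (x : ∀ N, Fin (l N) → α)
    (hx : ∀ N (i : Fin (l N)), x N i ∈ S i) :
    ∃ y : ℕ → α, ∀ M, ∃ N, ∃ h : M ≤ l N, ∀ i : Fin M, x N (Fin.castLE h i) = y i := by
  have key (i : ℕ) : ∃ w ∈ S i, ∀ᶠ N in (Filter.hyperfilter ℕ : Filter ℕ),
      ∃ h : i < l N, x N ⟨i, h⟩ = w := by
    rw [← Ultrafilter.eventually_exists_mem_iff (hS i)]
    filter_upwards [Nat.hyperfilter_le_atTop (Filter.eventually_ge_atTop i)] with N hN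
    exact ⟨_, hx N ⟨i, lt_of_le_of_lt hN (hl N)⟩, _, rfl⟩
  choose y _ hy using key
  refine ⟨y, fun M ↦ ?_⟩
  have hM := Nat.hyperfilter_le_atTop (Filter.eventually_ge_atTop M)
  have hagree := Filter.eventually_all.2 fun i : Fin M ↦ hy i
  obtain ⟨N, hN, hxN⟩ := (Filter.Eventually.and hM hagree).exists
  exact ⟨N, hN.trans (hl N).le, fun i ↦ (hxN i).2⟩

/-- Length Function Theorem: over a finite alphabet Γ, for every n and k there is
a computable bound L such that every k-controlled n-bad sequence of words over Γ
has length at most L. -/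
theorem length_function_theorem {Γ : Type*} [Fintype Γ] (n k : ℕ) :
    ∃ L : ℕ, ∀ (l : ℕ) (x : Fin l → List Γ),
      (∀ i : Fin l, (x i).length ≤ ((i : ℕ) + 1) * k) →
      (¬ ∃ f : Fin n → Fin l, StrictMono f ∧
        ∀ i j : Fin n, i ≤ j → (x (f i)) <+ (x (f j))) →
      l ≤ L := by
  by_contra! hcon
  choose l x hctrl hbad hl using hcon
  obtain ⟨y, hy⟩ := exists_seq_forall_frequently_agree
    (S := fun i ↦ {w : List Γ | w.length ≤ (i + 1) * k})
    (fun i ↦ List.finite_length_le Γ _) hl x hctrl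
  obtain ⟨g, hg⟩ := exists_sublist_monotone_subseq y
  obtain ⟨N, hN, hxN⟩ := hy (g n)
  obtain ⟨i, j, hij, hnot⟩ := hbad N (fun i ↦ Fin.castLE hN ⟨g i, g.strictMono i.2⟩)
    fun _ _ h ↦ g.strictMono h
  exact hnot (by simpa only [hxN] using hg i j hij)
end

section
/- (Cutting lemma for blue indices.) Let σ be a solution of the PEP^partial_codir instance (u, v, R, R'), of length N. Let a < b be two indices in [0,N] that are congruent and both blue, with left margins l_a and l_b. If l_a ⊑ l_b, then σ' = σ[0,a)·σ[b,N) is also a solution (and it is strictly shorter than σ). -/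
open List

/-- The extension of a morphism `u : Σ* → Γ*` (given by its values on letters)
to words: `app u w = u(w)`. -/
def app {S G : Type*} (u : S → List G) (w : List S) : List G := (w.map u).flatten

/-- `σ` is a solution of the PEP^partial_codir instance `(u, v, R, R')`:
`σ ∈ R`, `u(σ) ⊑ v(σ)`, and `u(τ) ⊑ v(τ)` for every suffix `τ` of `σ` in `R'`. -/
def IsSolution {S G : Type*} (u v : S → List G) (R R' : Set (List S))
    (σ : List S) : Prop :=
  σ ∈ R ∧ (app u σ) <+ (app v σ) ∧
    ∀ τ : List S, τ <:+ σ → τ ∈ R' → (app u τ) <+ (app v τ)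

/-- `x` and `y` are syntactically congruent with respect to the language `L`. -/
def SynCongr {S : Type*} (L : Set (List S)) (x y : List S) : Prop :=
  ∀ p q : List S, (p ++ x ++ q ∈ L) ↔ (p ++ y ++ q ∈ L)

theorem app_append {S G : Type*} (u : S → List G) (x y : List S) :
    app u (x ++ y) = app u x ++ app u y := by
  simp [app]

/-- Cancellation of a middle block: if `r ++ s <+ r' ++ s'`, and every suffix `l` of `r` that can be
put in front of `s` inside `s'` can be put in front of `t` inside `t'`, then
`r ++ t <+ r' ++ t'`. -/
theorem append_sublist_append_of_suffix {G : Type*} {r r' s s' t t' : List G}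
    (h : (r ++ s) <+ (r' ++ s')) (ht : t <+ t')
    (hl : ∀ l : List G, l <:+ r → (l ++ s) <+ s' → (l ++ t) <+ t') :
    (r ++ t) <+ (r' ++ t') := by
  obtain ⟨x, y, hxy, hx, hy⟩ := List.sublist_append_iff.1 h
  rcases List.append_eq_append_iff.1 hxy with ⟨z, rfl, -⟩ | ⟨l, rfl, rfl⟩
  · exact ((List.sublist_append_left r z).trans hx).append ht
  · rw [List.append_assoc]
    exact hx.append (hl l (List.suffix_append x l) hy)

/-- Cutting lemma for blue indices: if `a < b` are congruent blue indices with
left margins `l_a ⊑ l_b`, then `σ[0,a)·σ[b,N)` is a (strictly shorter) solution. -/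
theorem cutting_lemma_blue {S G : Type*} (u v : S → List G) (R R' : Set (List S))
    (σ : List S) (hsol : IsSolution u v R R' σ)
    (a b : ℕ) (hab : a < b) (hbN : b ≤ σ.length)
    (hcongR : SynCongr R (σ.drop a) (σ.drop b))
    (hcongR' : SynCongr R' (σ.drop a) (σ.drop b))
    (hbluea : (app u (σ.drop a)) <+ (app v (σ.drop a)))
    (hblueb : (app u (σ.drop b)) <+ (app v (σ.drop b)))
    (la lb : List G)
    (hlaSuf : la <:+ app u (σ.take a))
    (hlaEmb : (la ++ app u (σ.drop a)) <+ (app v (σ.drop a)))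
    (hlaMax : ∀ l : List G, l <:+ app u (σ.take a) →
      (l ++ app u (σ.drop a)) <+ (app v (σ.drop a)) → l.length ≤ la.length)
    (hlbSuf : lb <:+ app u (σ.take b))
    (hlbEmb : (lb ++ app u (σ.drop b)) <+ (app v (σ.drop b)))
    (hlbMax : ∀ l : List G, l <:+ app u (σ.take b) →
      (l ++ app u (σ.drop b)) <+ (app v (σ.drop b)) → l.length ≤ lb.length)
    (hll : la <+ lb) :
    IsSolution u v R R' (σ.take a ++ σ.drop b) ∧
      (σ.take a ++ σ.drop b).length < σ.length := by
  have key : ∀ ρ : List S, ρ <:+ σ.take a →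
      (app u (ρ ++ σ.drop a)) <+ (app v (ρ ++ σ.drop a)) →
      (app u (ρ ++ σ.drop b)) <+ (app v (ρ ++ σ.drop b)) := by
    rintro ρ ⟨p, hp⟩ h
    simp only [app_append] at h ⊢
    refine append_sublist_append_of_suffix h hblueb fun l hl hla => ?_
    have hl' : l <:+ app u (σ.take a) := by
      rw [← hp, app_append]
      exact hl.trans (List.suffix_append _ _)
    have hlla : l <:+ la := List.suffix_of_suffix_length_le hl' hlaSuf (hlaMax l hl' hla)
    exact ((hlla.sublist.trans hll).append_right _).trans hlbEmb
  obtain ⟨hR, hemb, hsuf⟩ := hsol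
  refine ⟨⟨?_, ?_, ?_⟩, ?_⟩
  · simpa using (hcongR (σ.take a) []).1 (by simpa using hR)
  · exact key _ List.suffix_rfl (by simpa using hemb)
  · rintro τ ⟨p, hp⟩ hτ
    rcases List.append_eq_append_iff.1 hp with ⟨ρ, hρ, rfl⟩ | ⟨q, -, hq⟩
    · have hρa : ρ <:+ σ.take a := ⟨p, hρ.symm⟩
      refine key ρ hρa (hsuf _ ⟨p, ?_⟩ ?_)
      · rw [← List.append_assoc, ← hρ, List.take_append_drop]
      · simpa using (hcongR' ρ []).2 (by simpa using hτ)
    · exact hsuf τ (List.IsSuffix.trans ⟨q, hq.symm⟩ (List.drop_suffix b σ)) hτ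
  · simp only [List.length_append, List.length_take, List.length_drop]
    omega
end

section
/- (Cutting lemma for red indices.) Let σ be a solution of the PEP^partial_codir instance (u, v, R, R'), of length N. Let a < b be two indices in [0,N] that are congruent and both red, with right margins r_a and r_b. If r_b ⊑ r_a, then σ' = σ[0,a)·σ[b,N) is also a solution (and it is strictly shorter than σ). -/
open List

/-- If `r` is the shortest prefix of `r ++ w` whose removal leaves a sublist of `z`, and
`r ++ w` itself is not a sublist of `z`, then any embedding of `x ++ (r ++ w)` in `y ++ z`
must embed `x ++ r` in `y`. -/
theorem append_sublist_left_of_minimal {G : Type*} {x y z r w : List G}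
    (hred : ¬ (r ++ w) <+ z)
    (hmin : ∀ r' w' : List G, r ++ w = r' ++ w' → w' <+ z → r.length ≤ r'.length)
    (h : (x ++ (r ++ w)) <+ (y ++ z)) : (x ++ r) <+ y := by
  obtain ⟨l₁, l₂, heq, h₁, h₂⟩ := List.sublist_append_iff.1 h
  rcases List.append_eq_append_iff.1 heq with ⟨c, rfl, hc⟩ | ⟨c, rfl, rfl⟩
  · have hpre : r <+: c :=
      List.prefix_of_prefix_length_le (List.prefix_append r w)
        (hc ▸ List.prefix_append c l₂) (hmin c l₂ hc h₂)
    exact (hpre.sublist.append_left x).trans h₁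
  · exact absurd ((List.sublist_append_right c (r ++ w)).trans h₂) hred

/-- Cutting lemma for red indices: if `a < b` are congruent red indices with
right margins `r_b ⊑ r_a`, then `σ[0,a)·σ[b,N)` is a (strictly shorter) solution. -/
theorem cutting_lemma_red {S G : Type*} (u v : S → List G) (R R' : Set (List S))
    (σ : List S) (hsol : IsSolution u v R R' σ)
    (a b : ℕ) (hab : a < b) (hbN : b ≤ σ.length)
    (hcongR : SynCongr R (σ.drop a) (σ.drop b))
    (hcongR' : SynCongr R' (σ.drop a) (σ.drop b))
    (hreda : ¬ (app u (σ.drop a)) <+ (app v (σ.drop a)))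
    (hredb : ¬ (app u (σ.drop b)) <+ (app v (σ.drop b)))
    (ra rb wa wb : List G)
    (hraPre : app u (σ.drop a) = ra ++ wa)
    (hraEmb : wa <+ (app v (σ.drop a)))
    (hraMin : ∀ r w : List G, app u (σ.drop a) = r ++ w →
      w <+ (app v (σ.drop a)) → ra.length ≤ r.length)
    (hrbPre : app u (σ.drop b) = rb ++ wb)
    (hrbEmb : wb <+ (app v (σ.drop b)))
    (hrbMin : ∀ r w : List G, app u (σ.drop b) = r ++ w →
      w <+ (app v (σ.drop b)) → rb.length ≤ r.length)
    (hrr : rb <+ ra) :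
    IsSolution u v R R' (σ.take a ++ σ.drop b) ∧
      (σ.take a ++ σ.drop b).length < σ.length := by
  have hkey : ∀ x : List S, (app u (x ++ σ.drop a)) <+ (app v (x ++ σ.drop a)) →
      (app u (x ++ σ.drop b)) <+ (app v (x ++ σ.drop b)) := by
    intro x hx
    rw [app_append, app_append, hraPre] at hx
    rw [hraPre] at hreda hraMin
    have hxr := append_sublist_left_of_minimal hreda hraMin hx
    rw [app_append, app_append, hrbPre, ← List.append_assoc]
    exact ((hrr.append_left _).trans hxr).append hrbEmb
  obtain ⟨hR, hmain, hsuf⟩ := hsol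
  refine ⟨⟨?_, hkey _ (by rwa [List.take_append_drop]), ?_⟩, ?_⟩
  · simpa [hR] using hcongR (σ.take a) []
  · rintro τ ⟨t, ht⟩ hτ
    rcases List.append_eq_append_iff.1 ht with ⟨x, hx, rfl⟩ | ⟨x, -, hx⟩
    · refine hkey x (hsuf _ ⟨t, ?_⟩ ?_)
      · rw [← List.append_assoc, ← hx, List.take_append_drop]
      · simpa using (hcongR' x []).2 (by simpa using hτ)
    · exact hsuf τ (List.IsSuffix.trans ⟨x, hx.symm⟩ (List.drop_suffix b σ)) hτ
  · simp only [List.length_append, List.length_take, List.length_drop]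
    omega
end

section
/- Let σ be a solution of the PEP^partial_codir instance (u, v, R, R'), of length N, and suppose |u(a)| ≤ K_u for every letter a ∈ Σ. Then: (1) for every blue index g, if there are exactly j blue indices strictly smaller than g, then |l_g| ≤ j·K_u; (2) for every red index b, if there are exactly j red indices in [b, N] (i.e., red indices ≥ b, including b itself), then |r_b| ≤ j·K_u. In other words, the sequence of left margins (listed in increasing order of blue indices) and the reversed sequence of right margins (listed in decreasing order of red indices) are K_u-controlled. -/
open List

theorem app_drop {S G : Type*} (u : S → List G) {σ : List S} {i : ℕ} (hi : i < σ.length) :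
    app u (σ.drop i) = u σ[i] ++ app u (σ.drop (i + 1)) := by
  rw [List.drop_eq_getElem_cons hi, app, List.map_cons, List.flatten_cons, app]

theorem app_take_succ {S G : Type*} (u : S → List G) {σ : List S} {i : ℕ}
    (hi : i < σ.length) : app u (σ.take (i + 1)) = app u (σ.take i) ++ u σ[i] := by
  rw [← List.take_append_getElem hi, app_append]
  simp [app]

theorem app_drop_succ_sublist {S G : Type*} (v : S → List G) {σ : List S} {i : ℕ}
    (hi : i < σ.length) : app v (σ.drop (i + 1)) <+ app v (σ.drop i) := by
  rw [app_drop v hi]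
  exact List.sublist_append_right _ _

/-- The number of indices below `n + 1` satisfying `P` exceeds the number below `n` by one
when `P n` holds. -/
theorem ncard_setOf_lt_succ {P : ℕ → Prop} {n : ℕ} (hn : P n) :
    {i : ℕ | i < n + 1 ∧ P i}.ncard = {i : ℕ | i < n ∧ P i}.ncard + 1 := by
  have h : {i : ℕ | i < n + 1 ∧ P i} = insert n {i : ℕ | i < n ∧ P i} := by
    ext i
    simp only [Set.mem_ofPred_eq, Set.mem_insert_iff]
    grind
  rw [h, Set.ncard_insert_of_notMem (by simp)
    ((Set.finite_Iio n).subset fun i hi => hi.1)]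

/-- The number of indices in `[b, n]` satisfying `P` exceeds the number in `[b + 1, n]` by one
when `P b` holds. -/
theorem ncard_setOf_ge {P : ℕ → Prop} {b n : ℕ} (hbn : b ≤ n) (hb : P b) :
    {i : ℕ | b ≤ i ∧ i ≤ n ∧ P i}.ncard =
      {i : ℕ | b + 1 ≤ i ∧ i ≤ n ∧ P i}.ncard + 1 := by
  have h : {i : ℕ | b ≤ i ∧ i ≤ n ∧ P i} =
      insert b {i : ℕ | b + 1 ≤ i ∧ i ≤ n ∧ P i} := by
    ext i
    simp only [Set.mem_ofPred_eq, Set.mem_insert_iff]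
    grind
  rw [h, Set.ncard_insert_of_notMem (by simp)
    ((Set.finite_Iic n).subset fun i hi => hi.2.1)]

/-- Any left factor that still fits at `g` is bounded by the number of blue indices below `g`. -/
theorem length_le_of_suffix_of_sublist {S G : Type*} (u v : S → List G) (σ : List S)
    (hσ : app u σ <+ app v σ) (Ku : ℕ) (hKu : ∀ a : S, (u a).length ≤ Ku) (g : ℕ)
    (hg : g ≤ σ.length) (l : List G) (hl : l <:+ app u (σ.take g))
    (hlv : (l ++ app u (σ.drop g)) <+ app v (σ.drop g)) :
    l.length ≤ {i : ℕ | i < g ∧ app u (σ.drop i) <+ app v (σ.drop i)}.ncard * Ku := by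
  induction g generalizing l with
  | zero =>
    have : l = [] := by simpa [app] using hl
    simp [this]
  | succ g ih =>
    have hg' : g < σ.length := hg
    rw [app_take_succ u hg'] at hl
    rcases List.suffix_or_suffix_of_suffix hl (List.suffix_append _ (u σ[g])) with h | ⟨m, rfl⟩
    · have hpos : 0 < {i : ℕ | i < g + 1 ∧ app u (σ.drop i) <+ app v (σ.drop i)}.ncard :=
        (Set.ncard_pos ((Set.finite_Iio (g + 1)).subset fun i hi => hi.1)).2
          ⟨0, by simp, by simpa using hσ⟩
      exact (h.length_le.trans (hKu _)).trans (Nat.le_mul_of_pos_left _ hpos)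
    · have hfit : (m ++ app u (σ.drop g)) <+ app v (σ.drop g) := by
        rw [app_drop u hg', ← List.append_assoc]
        exact hlv.trans (app_drop_succ_sublist v hg')
      have hm : m <:+ app u (σ.take g) := by
        obtain ⟨t, ht⟩ := hl
        exact ⟨t, by simpa [← List.append_assoc] using ht⟩
      have hblue := (List.sublist_append_right m _).trans hfit
      rw [ncard_setOf_lt_succ (P := fun i => app u (σ.drop i) <+ app v (σ.drop i)) hblue,
        List.length_append, Nat.add_mul, one_mul]
      exact Nat.add_le_add (ih hg'.le m hm hfit) (hKu _)

/-- At every index `b`, removing a prefix bounded by the number of red indices from `b` on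
makes the remaining image fit. -/
theorem exists_append_sublist_length_le {S G : Type*} (u v : S → List G) (σ : List S)
    (Ku : ℕ) (hKu : ∀ a : S, (u a).length ≤ Ku) (b : ℕ) (hb : b ≤ σ.length) :
    ∃ r w : List G, app u (σ.drop b) = r ++ w ∧ w <+ app v (σ.drop b) ∧
      r.length ≤ {i : ℕ | b ≤ i ∧ i ≤ σ.length ∧
        ¬ app u (σ.drop i) <+ app v (σ.drop i)}.ncard * Ku := by
  induction hb using Nat.decreasingInduction with
  | self => exact ⟨[], [], by simp [app]⟩
  | of_succ b hb ih =>
    by_cases hblue : app u (σ.drop b) <+ app v (σ.drop b)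
    · exact ⟨[], _, rfl, hblue, Nat.zero_le _⟩
    · obtain ⟨r, w, hrw, hw, hr⟩ := ih
      refine ⟨u σ[b] ++ r, w, ?_, hw.trans (app_drop_succ_sublist v hb), ?_⟩
      · rw [app_drop u hb, hrw, List.append_assoc]
      · rw [ncard_setOf_ge (P := fun i => ¬ app u (σ.drop i) <+ app v (σ.drop i)) hb.le hblue,
          List.length_append, Nat.add_mul, one_mul, add_comm]
        exact Nat.add_le_add hr (hKu _)

/-- The sequence of left margins (at blue indices, in increasing order) and the
reversed sequence of right margins (at red indices) are `K_u`-controlled: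
`|l_g| ≤ j·K_u` where `j` is the number of blue indices `< g`, and
`|r_b| ≤ j·K_u` where `j` is the number of red indices in `[b, N]`. -/
theorem margins_controlled_u {S G : Type*} (u v : S → List G) (R R' : Set (List S))
    (σ : List S) (hsol : IsSolution u v R R' σ)
    (Ku : ℕ) (hKu : ∀ a : S, (u a).length ≤ Ku) :
    (∀ g : ℕ, g ≤ σ.length →
      (app u (σ.drop g)) <+ (app v (σ.drop g)) →
      ∀ l : List G, l <:+ app u (σ.take g) →
        (l ++ app u (σ.drop g)) <+ (app v (σ.drop g)) →
        (∀ l' : List G, l' <:+ app u (σ.take g) →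
          (l' ++ app u (σ.drop g)) <+ (app v (σ.drop g)) → l'.length ≤ l.length) →
        l.length ≤
          {i : ℕ | i < g ∧ (app u (σ.drop i)) <+ (app v (σ.drop i))}.ncard * Ku) ∧
    (∀ b : ℕ, b ≤ σ.length →
      ¬ (app u (σ.drop b)) <+ (app v (σ.drop b)) →
      ∀ r w : List G, app u (σ.drop b) = r ++ w →
        w <+ (app v (σ.drop b)) →
        (∀ r' w' : List G, app u (σ.drop b) = r' ++ w' →
          w' <+ (app v (σ.drop b)) → r.length ≤ r'.length) →
        r.length ≤
          {i : ℕ | b ≤ i ∧ i ≤ σ.length ∧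
            ¬ (app u (σ.drop i)) <+ (app v (σ.drop i))}.ncard * Ku) := by
  refine ⟨fun g hg _ l hl hlv _ =>
    length_le_of_suffix_of_sublist u v σ hsol.2.1 Ku hKu g hg l hl hlv,
    fun b hb _ r w _ _ hmin => ?_⟩
  obtain ⟨r', w', hrw, hw, hr⟩ := exists_append_sublist_length_le u v σ Ku hKu b hb
  exact (hmin r' w' hrw hw).trans hr
end

section
/- Let u, v : Σ* → Γ* be morphisms with |u(a)| ≤ K for every letter a ∈ Σ, and let R, R' ⊆ Σ*. Suppose there is an equivalence relation ≈ on Σ* with at most m equivalence classes such that x ≈ y implies that x and y are syntactically congruent with respect to R and syntactically congruent with respect to R'. Suppose further that L ∈ ℕ is such that every K-controlled sequence of words over Γ of length greater than L is (m+1)-good. Then every solution σ of the PEP^partial_codir instance (u, v, R, R') with |σ| > 2L is not of minimal length: there exists a solution strictly shorter than σ. Consequently, the instance has a solution if and only if it has a solution of length at most 2L. -/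
open List

theorem app_length_le {S G : Type*} {u : S → List G} {K : ℕ}
    (hK : ∀ a : S, (u a).length ≤ K) (x : List S) : (app u x).length ≤ x.length * K := by
  induction x with
  | nil => simp [app]
  | cons a x ih =>
    have h : app u (a :: x) = u a ++ app u x := by simp [app]
    rw [h, List.length_append, List.length_cons, Nat.succ_mul]
    have := hK a
    omega

/-- If `B` is at least as long as every suffix of `A ++ B` embedding into `D`, then an embedding of
`A ++ B` into `C ++ D` maps `A` into `C`. -/
theorem sublist_left_of_maximal_right {G : Type*} {A B C D : List G} (h : A ++ B <+ C ++ D)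
    (hmax : ∀ t, t <:+ A ++ B → t <+ D → t.length ≤ B.length) : A <+ C := by
  obtain ⟨l₁, l₂, he, h₁, h₂⟩ := List.sublist_append_iff.1 h
  have hl := hmax l₂ (he ▸ List.suffix_append _ _) h₂
  have hlen := congrArg List.length he
  simp only [List.length_append] at hlen
  have hp : A <+: l₁ := List.prefix_of_prefix_length_le (List.prefix_append A B)
    (he ▸ List.prefix_append _ _) (by omega)
  exact hp.sublist.trans h₁

/-- A suffix of `x ++ y` is a suffix of `y` or extends `y` by a suffix of `x`. -/
theorem suffix_append_cases {S : Type*} {t x y : List S} (h : t <:+ x ++ y) :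
    t <:+ y ∨ ∃ z, z <:+ x ∧ t = z ++ y := by
  rcases le_total t.length y.length with hl | hl
  · exact Or.inl (List.suffix_of_suffix_length_le h (List.suffix_append _ _) hl)
  · obtain ⟨z, rfl⟩ := List.suffix_of_suffix_length_le (List.suffix_append x y) h hl
    exact Or.inr ⟨z, List.suffix_append_self_iff.1 h, rfl⟩

/-- Replacing the suffix `ya` of a solution by a congruent `yb` gives a solution, provided the
embeddings that are required of the suffixes reaching beyond `ya` carry over. -/
theorem IsSolution.replace_suffix {S G : Type*} {u v : S → List G} {R R' : Set (List S)}
    {x ya yb : List S} (hsol : IsSolution u v R R' (x ++ ya)) (hsuf : yb <:+ ya)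
    (hR : SynCongr R ya yb) (hR' : SynCongr R' ya yb)
    (hcut : ∀ z, z <:+ x → app u (z ++ ya) <+ app v (z ++ ya) →
      app u (z ++ yb) <+ app v (z ++ yb)) : IsSolution u v R R' (x ++ yb) := by
  refine ⟨?_, hcut x List.suffix_rfl hsol.2.1, fun τ hτ hτR => ?_⟩
  · simpa using (hR x []).1 (by simpa using hsol.1)
  · rcases suffix_append_cases hτ with h | ⟨z, hz, rfl⟩
    · exact hsol.2.2 τ (h.trans (hsuf.trans (List.suffix_append _ _))) hτR
    · refine hcut z hz (hsol.2.2 _ (List.suffix_append_self_iff.2 hz) ?_)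
      simpa using (hR' z []).2 (by simpa using hτR)

/-- Shortening at two positions where the suffix of `W` matched by `v` reaches beyond `u`. -/
theorem sublist_replace_of_surplus {G : Type*} {W s r r' Z Y Y' C D D' : List G}
    (hW : W = s ++ (r ++ Y)) (hmax : ∀ t, t <:+ W → t <+ D → t.length ≤ (r ++ Y).length)
    (hZ : Z ++ Y <:+ W) (hr : r <+ r') (hr' : r' ++ Y' <+ D') (h : Z ++ Y <+ C ++ D) :
    Z ++ Y' <+ C ++ D' := by
  have hrD : r ++ Y' <+ D' := (hr.append_right Y').trans hr'
  have hrW : r ++ Y <:+ W := hW ▸ List.suffix_append _ _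
  rcases le_total Z.length r.length with hl | hl
  · have hs : Z <:+ r := List.suffix_append_self_iff.1
      (List.suffix_of_suffix_length_le hZ hrW (by simpa using hl))
    exact ((hs.sublist.append_right Y').trans hrD).trans (List.sublist_append_right _ _)
  · obtain ⟨q, rfl⟩ : r <:+ Z := List.suffix_append_self_iff.1
      (List.suffix_of_suffix_length_le hrW hZ (by simpa using hl))
    rw [List.append_assoc] at h hZ
    have hq : q <+ C := sublist_left_of_maximal_right h fun t ht => hmax t (ht.trans hZ)
    simpa using hq.append hrD

/-- Shortening at two positions where the suffix of `W` matched by `v` falls short of `u`. -/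
theorem sublist_replace_of_deficit {G : Type*} {W l t l' t' Z C D D' : List G}
    (hmax : ∀ q, q <:+ W → q <+ D → q.length ≤ t.length)
    (hZ : Z ++ (l ++ t) <:+ W) (hl : l' <+ l) (ht' : t' <+ D') (h : Z ++ (l ++ t) <+ C ++ D) :
    Z ++ (l' ++ t') <+ C ++ D' := by
  rw [← List.append_assoc] at h hZ ⊢
  have hC : Z ++ l <+ C := sublist_left_of_maximal_right h fun q hq => hmax q (hq.trans hZ)
  exact ((hl.append_left Z).trans hC).append ht'

/-- A quantity growing by at most `K` after an index in `p`, and at most `K` after any other index,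
is controlled by the number of previous indices in `p`. -/
theorem le_mul_count_succ {p : ℕ → Prop} [DecidablePred p] {d : ℕ → ℕ} {K N : ℕ} (h0 : d 0 ≤ K)
    (hp : ∀ i < N, p i → d (i + 1) ≤ d i + K) (hn : ∀ i < N, ¬ p i → d (i + 1) ≤ K) :
    ∀ i ≤ N, d i ≤ (Nat.count p i + 1) * K := by
  intro i
  induction i with
  | zero => intro _; simpa using h0
  | succ i ih =>
    intro hi
    have ih := ih (by omega)
    by_cases h : p i
    · have := hp i hi h
      rw [Nat.count_succ, if_pos h, Nat.succ_mul]
      omega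
    · have := hn i hi h
      rw [Nat.count_succ, if_neg h, Nat.succ_mul]
      omega

/-- A goodness bound for controlled sequences, combined with the pigeonhole principle, for sequences
indexed by those `i ≤ N` that satisfy `p`. -/
theorem exists_sublist_pair {G : Type*} {m L K N : ℕ}
    (hL : ∀ (l : ℕ) (x : Fin l → List G), L < l →
      (∀ i : Fin l, (x i).length ≤ ((i : ℕ) + 1) * K) →
      ∃ g : Fin (m + 1) → Fin l, StrictMono g ∧
        ∀ i j : Fin (m + 1), i ≤ j → (x (g i)) <+ (x (g j)))
    {p : ℕ → Prop} [DecidablePred p] (hcount : L < Nat.count p (N + 1)) (w : ℕ → List G)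
    (hw : ∀ i ≤ N, (w i).length ≤ (Nat.count p i + 1) * K) (F : ℕ → Fin m) :
    ∃ a b, a < b ∧ b ≤ N ∧ p a ∧ p b ∧ w a <+ w b ∧ F a = F b := by
  have hlt (j : Fin (Nat.count p (N + 1))) (hf : (Set.ofPred p).Finite) : (j : ℕ) < hf.toFinset.card :=
    j.2.trans_le (Nat.count_le_card hf _)
  have hN (j : Fin (Nat.count p (N + 1))) : Nat.nth p j ≤ N :=
    Nat.lt_succ_iff.1 (Nat.nth_lt_of_lt_count j.2)
  obtain ⟨g, hg, hgw⟩ := hL _ (fun j => w (Nat.nth p j)) hcount fun j => by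
    simpa [Nat.count_nth (hlt j)] using hw _ (hN j)
  obtain ⟨i, j, hij, hF⟩ : ∃ i j : Fin (m + 1), i < j ∧
      F (Nat.nth p (g i)) = F (Nat.nth p (g j)) := by
    obtain ⟨i, j, hne, hF⟩ := Fintype.exists_ne_map_eq_of_card_lt
      (fun i : Fin (m + 1) => F (Nat.nth p (g i))) (by simp)
    rcases lt_or_gt_of_ne hne with h | h
    · exact ⟨i, j, h, hF⟩
    · exact ⟨j, i, h, hF.symm⟩
  exact ⟨_, _, Nat.nth_lt_nth' (hg hij) (hlt _), hN _, Nat.nth_mem _ (hlt _), Nat.nth_mem _ (hlt _),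
    hgw i j hij.le, hF⟩

theorem count_add_count_not_reflect (p : ℕ → Prop) [DecidablePred p] (N : ℕ) :
    Nat.count p (N + 1) + Nat.count (fun k => ¬ p (N - k)) (N + 1) = N + 1 := by
  have h1 (q : ℕ → Prop) [DecidablePred q] :
      Nat.count q (N + 1) = ∑ k ∈ Finset.range (N + 1), if q k then 1 else 0 := by
    rw [Nat.count_eq_card_filter_range, Finset.card_filter]
  rw [h1, h1, ← Finset.sum_range_reflect, ← Finset.sum_add_distrib]
  trans ∑ k ∈ Finset.range (N + 1), 1
  · refine Finset.sum_congr rfl fun k _ => ?_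
    have : N + 1 - 1 - k = N - k := by omega
    rw [this]
    by_cases h : p (N - k) <;> simp [h]
  · simp

/-- A long solution can be shortened by cutting out a factor. -/
theorem IsSolution.exists_shorter {S G : Type*} {u v : S → List G} {R R' : Set (List S)}
    {K : ℕ} (hK : ∀ a : S, (u a).length ≤ K) {m : ℕ} {f : List S → Fin m}
    (hf : ∀ x y : List S, f x = f y → SynCongr R x y ∧ SynCongr R' x y) {L : ℕ}
    (hL : ∀ (l : ℕ) (x : Fin l → List G), L < l →
      (∀ i : Fin l, (x i).length ≤ ((i : ℕ) + 1) * K) →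
      ∃ g : Fin (m + 1) → Fin l, StrictMono g ∧
        ∀ i j : Fin (m + 1), i ≤ j → (x (g i)) <+ (x (g j)))
    {σ : List S} (hσ : IsSolution u v R R' σ) (hlen : 2 * L < σ.length) :
    ∃ σ' : List S, IsSolution u v R R' σ' ∧ σ'.length < σ.length := by
  classical
  set W := app u σ with hWdef
  have hex (i : ℕ) : ∃ n, W.drop n <+ app v (σ.drop i) := ⟨W.length, by simp⟩
  -- the suffix `W.drop (P i)` is the longest one that embeds into `app v (σ.drop i)`
  let P (i : ℕ) : ℕ := Nat.find (hex i)
  have hP (i : ℕ) : W.drop (P i) <+ app v (σ.drop i) := Nat.find_spec (hex i)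
  have hPmin (i n : ℕ) (h : W.drop n <+ app v (σ.drop i)) : P i ≤ n := Nat.find_min' (hex i) h
  have hPW (i : ℕ) : P i ≤ W.length := hPmin i _ (by simp)
  have hmax (i : ℕ) (t : List G) (ht : t <:+ W) (htv : t <+ app v (σ.drop i)) :
      t.length ≤ (W.drop (P i)).length := by
    rw [List.suffix_iff_eq_drop] at ht
    have := hPmin i _ (ht ▸ htv)
    have h2 := congrArg List.length ht
    rw [List.length_drop] at h2 ⊢
    omega
  have hsplit (i : ℕ) : W = app u (σ.take i) ++ app u (σ.drop i) := by
    rw [← app_append, List.take_append_drop]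
  let c (i : ℕ) : ℕ := (app u (σ.take i)).length
  have hc (i : ℕ) : W.drop (c i) = app u (σ.drop i) := by
    rw [hsplit i]; simp [c]
  have hcW (i : ℕ) : c i ≤ W.length := by
    rw [hsplit i]; simp [c]
  have hcsucc (i : ℕ) : c (i + 1) ≤ c i + K := by
    have h := app_length_le hK ((σ.drop i).take 1)
    have h1 : ((σ.drop i).take 1).length * K ≤ 1 * K :=
      Nat.mul_le_mul_right K (List.length_take_le _ _)
    simp only [c, List.take_add, app_append, List.length_append]
    omega
  have hPsucc (i : ℕ) : P i ≤ P (i + 1) := by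
    refine hPmin i _ ((hP (i + 1)).trans ?_)
    have h : σ.drop i = (σ.drop i).take 1 ++ σ.drop (i + 1) := by
      rw [← List.drop_drop, List.take_append_drop]
    rw [h, app_append]
    exact List.sublist_append_right _ _
  have hP0 : P 0 = 0 := Nat.le_zero.1 (hPmin 0 0 (by simpa using hσ.2.1))
  have hcN : c σ.length = W.length := by simp [c, hWdef]
  have hcut (a b : ℕ) (hab : a < b) (hb : b ≤ σ.length) (hfab : f (σ.drop a) = f (σ.drop b))
      (h : ∀ z, z <:+ σ.take a → app u (z ++ σ.drop a) <+ app v (z ++ σ.drop a) →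
        app u (z ++ σ.drop b) <+ app v (z ++ σ.drop b)) :
      ∃ σ' : List S, IsSolution u v R R' σ' ∧ σ'.length < σ.length := by
    have hcg := hf _ _ hfab
    refine ⟨_, IsSolution.replace_suffix (by rwa [List.take_append_drop])
      (List.drop_suffix_drop_left σ hab.le) hcg.1 hcg.2 h, ?_⟩
    simp only [List.length_append, List.length_take, List.length_drop]
    omega
  have hZW (a : ℕ) (z : List S) (hz : z <:+ σ.take a) : app u z ++ app u (σ.drop a) <:+ W := by
    obtain ⟨q, hq⟩ := hz
    refine ⟨app u q, ?_⟩
    rw [← List.append_assoc, ← app_append, hq, ← hsplit]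
  have hdec {i j : ℕ} (hij : i ≤ j) : W.drop i = (W.drop i).take (j - i) ++ W.drop j := by
    conv_lhs => rw [← List.take_append_drop (j - i) (W.drop i), List.drop_drop,
      Nat.add_sub_cancel' hij]
  have htot := count_add_count_not_reflect (fun i => P i ≤ c i) σ.length
  rcases lt_or_ge L (Nat.count (fun i => P i ≤ c i) (σ.length + 1)) with hcount | hcount
  · obtain ⟨a, b, hab, hb, ha', hb', hw, hF⟩ := exists_sublist_pair hL hcount
      (fun i => (W.drop (P i)).take (c i - P i))
      (fun i hi => (List.length_take_le _ _).trans
        (le_mul_count_succ (d := fun i => c i - P i) (N := σ.length) (by simp [c, app])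
          (fun i _ h => by have := hcsucc i; have := hPsucc i; grind)
          (fun i _ h => by have := hcsucc i; have := hPsucc i; grind) i hi))
      (fun i => f (σ.drop i))
    refine hcut a b hab hb hF fun z hz h => ?_
    rw [app_append, app_append] at h ⊢
    have hda := hdec ha'
    have hdb := hdec hb'
    rw [hc] at hda hdb
    exact sublist_replace_of_surplus (s := W.take (P a))
      (by rw [← hda, List.take_append_drop]) (hda ▸ hmax a) (hZW a z hz) hw (hdb ▸ hP b) h
  · obtain ⟨k, l, hkl, hl, hk', hl', hw, hF⟩ := exists_sublist_pair hL
      (p := fun k => ¬ P (σ.length - k) ≤ c (σ.length - k)) (N := σ.length) (by omega)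
      (fun k => (W.drop (c (σ.length - k))).take (P (σ.length - k) - c (σ.length - k)))
      (fun i hi => (List.length_take_le _ _).trans
        (le_mul_count_succ (d := fun k => P (σ.length - k) - c (σ.length - k)) (N := σ.length)
          (by have := hPW σ.length; simp only [Nat.sub_zero]; omega)
          (fun i hi h => by
            obtain ⟨j, hj, hj'⟩ : ∃ j, σ.length - (i + 1) = j ∧ σ.length - i = j + 1 :=
              ⟨_, rfl, by omega⟩
            have := hcsucc j; have := hPsucc j
            simp only [hj, hj'] at h ⊢
            omega)
          (fun i hi h => by
            obtain ⟨j, hj, hj'⟩ : ∃ j, σ.length - (i + 1) = j ∧ σ.length - i = j + 1 :=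
              ⟨_, rfl, by omega⟩
            have := hcsucc j; have := hPsucc j
            simp only [hj, hj'] at h ⊢
            omega) i hi))
      (fun k => f (σ.drop (σ.length - k)))
    refine hcut (σ.length - l) (σ.length - k) (by omega) (by omega) hF.symm fun z hz h => ?_
    rw [app_append, app_append] at h ⊢
    have hda := hdec (not_le.1 hl').le
    have hdb := hdec (not_le.1 hk').le
    rw [hc] at hda hdb
    have hzW := hZW _ z hz
    rw [hda] at h hzW
    rw [hdb]
    rw [hc, hc] at hw
    exact sublist_replace_of_deficit (hmax _) hzW hw (hP _) h

/-- Theorem (short solutions): if `u` has expansion factor at most `K`, the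
syntactic congruences of `R` and `R'` are jointly refined by an equivalence with
at most `m` classes, and `L` bounds the length of `(m+1)`-bad `K`-controlled
sequences over `Γ`, then any solution of length `> 2L` is not of minimal length;
consequently the instance has a solution iff it has one of length `≤ 2L`. -/
theorem short_solution_theorem {S G : Type*} (u v : S → List G) (R R' : Set (List S))
    (K : ℕ) (hK : ∀ a : S, (u a).length ≤ K)
    (m : ℕ) (E : List S → List S → Prop) (hE : Equivalence E)
    (f : List S → Fin m) (hf : ∀ x y : List S, E x y ↔ f x = f y)
    (hcong : ∀ x y : List S, E x y → SynCongr R x y ∧ SynCongr R' x y)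
    (L : ℕ)
    (hL : ∀ (l : ℕ) (x : Fin l → List G), L < l →
      (∀ i : Fin l, (x i).length ≤ ((i : ℕ) + 1) * K) →
      ∃ g : Fin (m + 1) → Fin l, StrictMono g ∧
        ∀ i j : Fin (m + 1), i ≤ j → (x (g i)) <+ (x (g j))) :
    (∀ σ : List S, IsSolution u v R R' σ → 2 * L < σ.length →
      ∃ σ' : List S, IsSolution u v R R' σ' ∧ σ'.length < σ.length) ∧
    ((∃ σ : List S, IsSolution u v R R' σ) ↔
      (∃ σ : List S, IsSolution u v R R' σ ∧ σ.length ≤ 2 * L)) := by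
  have hshort : ∀ σ : List S, IsSolution u v R R' σ → 2 * L < σ.length →
      ∃ σ' : List S, IsSolution u v R R' σ' ∧ σ'.length < σ.length := fun σ hσ hlen =>
    hσ.exists_shorter hK (fun x y h => hcong x y ((hf x y).2 h)) hL hlen
  refine ⟨hshort, fun ⟨σ, hσ⟩ => ?_, fun ⟨σ, hσ, _⟩ => ⟨σ, hσ⟩⟩
  induction hn : σ.length using Nat.strong_induction_on generalizing σ with
  | _ n ih =>
    by_cases h : σ.length ≤ 2 * L
    · exact ⟨σ, hσ, h⟩
    · obtain ⟨σ', hσ', hlt⟩ := hshort σ hσ (not_le.1 h)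
      exact ih _ (hn ▸ hlt) σ' hσ' rfl
end

section
/- Let σ be a solution of the PEP^partial_codir instance (u, v, R, R'), of length N. Suppose a < b are two blue indices in [0,N], with margins s_a and s_b (the longest prefixes of v(σ[a,N)) resp. v(σ[b,N)) whose removal still leaves u(σ[a,N)) resp. u(σ[b,N)) embedded). If s_b ⊑ s_a, then for all k ≥ 1: s_a·(u(σ[a,b)))^k ⊑ (v(σ[a,b)))^k·s_b. -/
open List

theorem sublist_of_append_sublist_of_maximal_margin {G : Type*} {x y U V s w : List G}
    (h : x ++ U <+ V ++ y) (hy : y = s ++ w)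
    (hmax : ∀ s' w' : List G, y = s' ++ w' → U <+ w' → s'.length ≤ s.length) :
    x <+ V ++ s := by
  obtain ⟨p, q, hpq, hxp, hUq⟩ := append_sublist_iff.1 h
  rw [hy, ← append_assoc] at hpq
  obtain ⟨t, rfl, rfl⟩ | ⟨t, ht, -⟩ := append_eq_append_iff.1 hpq
  · have hlen := hmax (s ++ t) q (by rw [hy, append_assoc]) hUq
    obtain rfl : t = [] := by simpa using hlen
    simpa using hxp
  · rw [ht]
    exact hxp.trans (sublist_append_left p t)

theorem append_flatten_replicate_sublist {G : Type*} {x y U V : List G}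
    (h : x ++ U <+ V ++ y) (hyx : y <+ x) (k : ℕ) :
    x ++ (replicate (k + 1) U).flatten <+ (replicate (k + 1) V).flatten ++ y := by
  induction k with
  | zero => simpa using h
  | succ k ih =>
    rw [replicate_succ, flatten_cons, replicate_succ (a := V), flatten_cons, append_assoc,
      ← append_assoc]
    refine (h.append_right _).trans ?_
    rw [append_assoc]
    exact ((hyx.append_right _).trans ih).append_left V

/-- If `a < b` are blue indices with right margins `s_a`, `s_b` and `s_b ⊑ s_a`,
then for all `k ≥ 1`, `s_a·(u(σ[a,b)))^k ⊑ (v(σ[a,b)))^k·s_b`. -/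
theorem iteration_blue_aux {S G : Type*} (u v : S → List G) (R R' : Set (List S))
    (σ : List S) (hsol : IsSolution u v R R' σ)
    (a b : ℕ) (hab : a < b) (hbN : b ≤ σ.length)
    (sa sb wa wb : List G)
    (hvaPre : app v (σ.drop a) = sa ++ wa)
    (huaEmb : (app u (σ.drop a)) <+ wa)
    (hsaMax : ∀ s w : List G, app v (σ.drop a) = s ++ w →
      (app u (σ.drop a)) <+ w → s.length ≤ sa.length)
    (hvbPre : app v (σ.drop b) = sb ++ wb)
    (hubEmb : (app u (σ.drop b)) <+ wb)
    (hsbMax : ∀ s w : List G, app v (σ.drop b) = s ++ w →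
      (app u (σ.drop b)) <+ w → s.length ≤ sb.length)
    (hss : sb <+ sa) :
    ∀ k : ℕ, 1 ≤ k →
      (sa ++ (List.replicate k (app u ((σ.drop a).take (b - a)))).flatten) <+
        ((List.replicate k (app v ((σ.drop a).take (b - a)))).flatten ++ sb) := by
  intro k hk
  obtain ⟨k, rfl⟩ := Nat.exists_eq_add_of_le' hk
  have hdrop : σ.drop a = (σ.drop a).take (b - a) ++ σ.drop b := by
    conv_lhs => rw [← take_append_drop (b - a) (σ.drop a)]
    rw [drop_drop, Nat.add_sub_cancel' hab.le]
  refine append_flatten_replicate_sublist ?_ hss k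
  refine sublist_of_append_sublist_of_maximal_margin ?_ hvbPre hsbMax
  rw [append_assoc, ← app_append, ← app_append, ← hdrop, hvaPre]
  exact huaEmb.append_left sa
end

section
/- (Iteration lemma for blue indices.) Let σ be a solution of the PEP^partial_codir instance (u, v, R, R'), of length N. Let a < b be two indices in [0,N] that are congruent and both blue, with margins s_a and s_b. If s_b ⊑ s_a, then for every k ≥ 1, the word σ' = σ[0,a)·(σ[a,b))^k·σ[b,N) is a solution. In particular, if such a pair of indices exists, the instance has infinitely many solutions. -/
open List

theorem suffix_append_iff_exists {S : Type*} {t x y : List S} :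
    t <:+ x ++ y ↔ t <:+ y ∨ ∃ t', t = t' ++ y ∧ t' <:+ x := by
  constructor
  · rintro ⟨r, hr⟩
    rcases List.append_eq_append_iff.1 hr with ⟨c, rfl, rfl⟩ | ⟨c, rfl, rfl⟩
    · exact Or.inr ⟨c, rfl, List.suffix_append r c⟩
    · exact Or.inl (List.suffix_append c t)
  · rintro (h | ⟨t', rfl, r, rfl⟩)
    · exact h.trans (List.suffix_append x y)
    · exact ⟨r, by simp⟩

/-- If `s` is the longest prefix of `s ++ w` whose removal leaves room for `y`, then any embedding
of `x ++ y` in `p ++ (s ++ w)` sends `x` into `p ++ s`. -/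
theorem sublist_append_of_maximal_margin {G : Type*} {x y p s w : List G}
    (hmax : ∀ s' w' : List G, s ++ w = s' ++ w' → y <+ w' → s'.length ≤ s.length)
    (h : x ++ y <+ p ++ (s ++ w)) : x <+ p ++ s := by
  obtain ⟨r₁, r₂, hr, hx, hy⟩ := List.append_sublist_iff.1 h
  rcases List.append_eq_append_iff.1 hr with ⟨c, rfl, hc⟩ | ⟨c, rfl, -⟩
  · have hcs : c <+: s := List.prefix_of_prefix_length_le ⟨r₂, hc.symm⟩ ⟨w, rfl⟩ (hmax c r₂ hc hy)
    exact hx.trans (hcs.sublist.append_left p)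
  · exact hx.trans ((List.sublist_append_left r₁ c).trans (List.sublist_append_left _ s))

theorem sublist_app_replicate {S G : Type*} {u v : S → List G} {X : List S} {s : List G}
    (h : s ++ app u X <+ app v X ++ s) (j : ℕ) :
    s ++ app u (List.replicate j X).flatten <+ app v (List.replicate j X).flatten ++ s := by
  induction j with
  | zero => simp [app]
  | succ j ih =>
    have h₁ := h.append_right (app u (List.replicate j X).flatten)
    have h₂ := ih.append_left (app v X)
    rw [List.replicate_succ, List.flatten_cons, app_append, app_append]
    simp only [List.append_assoc] at h₁ h₂ ⊢
    exact h₁.trans h₂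

theorem SynCongr.append_replicate_mem_iff {S : Type*} {L : Set (List S)} {X B : List S}
    (h : SynCongr L (X ++ B) B) (P : List S) (j : ℕ) :
    P ++ (List.replicate j X).flatten ++ B ∈ L ↔ P ++ B ∈ L := by
  induction j with
  | zero => simp
  | succ j ih =>
    have := h (P ++ (List.replicate j X).flatten) []
    rw [← ih, List.replicate_succ', List.flatten_append]
    simpa using this

theorem exists_of_suffix_append_replicate {S : Type*} {Q X : List S} (hX : X <:+ Q) {j : ℕ}
    {t : List S} (ht : t <:+ Q ++ (List.replicate j X).flatten) :
    ∃ Y i, t = Y ++ (List.replicate i X).flatten ∧ Y <:+ Q := by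
  induction j generalizing t with
  | zero => exact ⟨t, 0, by simp, by simpa using ht⟩
  | succ j ih =>
    rw [List.replicate_succ', List.flatten_append, ← List.append_assoc, List.flatten_singleton,
      suffix_append_iff_exists] at ht
    rcases ht with ht | ⟨t', rfl, ht'⟩
    · exact ⟨t, 0, by simp, ht.trans hX⟩
    · obtain ⟨Y, i, rfl, hY⟩ := ih ht'
      exact ⟨Y, i + 1, by simp [List.replicate_succ'], hY⟩

/-- Pumping `X` in a solution `Q ++ B` with `X` a suffix of `Q`, when the right margin `s` of `B`
satisfies `s · u(X) ⊑ v(X) · s`. -/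
theorem IsSolution.append_replicate {S G : Type*} {u v : S → List G} {R R' : Set (List S)}
    {Q X B : List S} {s w : List G} (hsol : IsSolution u v R R' (Q ++ B)) (hX : X <:+ Q)
    (hR : SynCongr R (X ++ B) B) (hR' : SynCongr R' (X ++ B) B)
    (hvB : app v B = s ++ w) (huB : app u B <+ w)
    (hmax : ∀ s' w' : List G, app v B = s' ++ w' → app u B <+ w' → s'.length ≤ s.length)
    (hs : s ++ app u X <+ app v X ++ s) (j : ℕ) :
    IsSolution u v R R' (Q ++ (List.replicate j X).flatten ++ B) := by
  obtain ⟨hmem, hemb, hsuf⟩ := hsol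
  have pump : ∀ (P : List S) (i : ℕ), app u (P ++ B) <+ app v (P ++ B) →
      app u (P ++ (List.replicate i X).flatten ++ B) <+
        app v (P ++ (List.replicate i X).flatten ++ B) := by
    intro P i h
    rw [app_append, app_append, hvB] at h
    rw [hvB] at hmax
    have h₁ := (sublist_append_of_maximal_margin hmax h).append_right
      (app u (List.replicate i X).flatten)
    have h₂ := (sublist_app_replicate hs i).append_left (app v P)
    rw [← List.append_assoc] at h₂
    have h₃ := (h₁.trans h₂).append huB
    simpa only [app_append, hvB, List.append_assoc] using h₃
  refine ⟨(hR.append_replicate_mem_iff Q j).2 hmem, pump Q j hemb, fun τ hτ hτR' => ?_⟩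
  rcases suffix_append_iff_exists.1 hτ with hτ | ⟨t, rfl, ht⟩
  · exact hsuf τ (hτ.trans (List.suffix_append Q B)) hτR'
  · obtain ⟨Y, i, rfl, hY⟩ := exists_of_suffix_append_replicate hX ht
    refine pump Y i (hsuf _ ?_ ((hR'.append_replicate_mem_iff Y i).1 hτR'))
    exact suffix_append_iff_exists.2 (Or.inr ⟨Y, rfl, hY⟩)

/-- Iteration lemma for blue indices: if `a < b` are congruent blue indices with
right margins `s_b ⊑ s_a`, then for every `k ≥ 1`,
`σ[0,a)·(σ[a,b))^k·σ[b,N)` is a solution; in particular the instance has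
infinitely many solutions. -/
theorem iteration_lemma_blue {S G : Type*} (u v : S → List G) (R R' : Set (List S))
    (σ : List S) (hsol : IsSolution u v R R' σ)
    (a b : ℕ) (hab : a < b) (hbN : b ≤ σ.length)
    (hcongR : SynCongr R (σ.drop a) (σ.drop b))
    (hcongR' : SynCongr R' (σ.drop a) (σ.drop b))
    (hbluea : (app u (σ.drop a)) <+ (app v (σ.drop a)))
    (hblueb : (app u (σ.drop b)) <+ (app v (σ.drop b)))
    (sa sb wa wb : List G)
    (hvaPre : app v (σ.drop a) = sa ++ wa)
    (huaEmb : (app u (σ.drop a)) <+ wa)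
    (hsaMax : ∀ s w : List G, app v (σ.drop a) = s ++ w →
      (app u (σ.drop a)) <+ w → s.length ≤ sa.length)
    (hvbPre : app v (σ.drop b) = sb ++ wb)
    (hubEmb : (app u (σ.drop b)) <+ wb)
    (hsbMax : ∀ s w : List G, app v (σ.drop b) = s ++ w →
      (app u (σ.drop b)) <+ w → s.length ≤ sb.length)
    (hss : sb <+ sa) :
    (∀ k : ℕ, 1 ≤ k →
      IsSolution u v R R'
        (σ.take a ++ (List.replicate k ((σ.drop a).take (b - a))).flatten ++ σ.drop b)) ∧
    (∀ M : ℕ, ∃ σ' : List S, IsSolution u v R R' σ' ∧ M < σ'.length) := by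
  set X := (σ.drop a).take (b - a) with hX
  have hXB : σ.drop a = X ++ σ.drop b := by
    have := (List.take_append_drop (b - a) (σ.drop a)).symm
    rwa [List.drop_drop, Nat.add_sub_cancel' hab.le] at this
  have hσ : σ = σ.take a ++ X ++ σ.drop b := by
    rw [List.append_assoc, ← hXB, List.take_append_drop]
  have hs : sb ++ app u X <+ app v X ++ sb := by
    have hsa : sa ++ app u X <+ app v X ++ sb := by
      rw [hvbPre] at hsbMax
      refine sublist_append_of_maximal_margin hsbMax ?_
      rw [← hvbPre, ← app_append, ← hXB, hvaPre, List.append_assoc, ← app_append, ← hXB]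
      exact huaEmb.append_left sa
    exact (hss.append_right _).trans hsa
  have main : ∀ k : ℕ, 1 ≤ k → IsSolution u v R R'
      (σ.take a ++ (List.replicate k X).flatten ++ σ.drop b) := by
    intro k hk
    obtain ⟨j, rfl⟩ := Nat.exists_eq_succ_of_ne_zero (Nat.one_le_iff_ne_zero.1 hk)
    rw [hσ] at hsol
    rw [hXB] at hcongR hcongR'
    have := hsol.append_replicate (List.suffix_append _ X) hcongR hcongR' hvbPre hubEmb hsbMax hs j
    simpa [List.replicate_succ] using this
  refine ⟨main, fun M => ⟨_, main (M + 1) (Nat.le_add_left 1 M), ?_⟩⟩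
  have hXlen : 1 ≤ X.length := by
    rw [hX, List.length_take, List.length_drop]
    omega
  have hlen := Nat.le_mul_of_pos_right (M + 1) hXlen
  simp only [List.length_append, List.length_flatten, List.map_replicate, List.sum_replicate,
    smul_eq_mul]
  omega
end

section
/- (Iteration lemma for red indices.) Let σ be a solution of the PEP^partial_codir instance (u, v, R, R'), of length N. Let a < b be two indices in [0,N] that are congruent and both red, with margins t_a and t_b. If t_a ⊑ t_b, then for every k ≥ 1, the word σ' = σ[0,a)·(σ[a,b))^k·σ[b,N) is a solution. In particular, if such a pair of indices exists, the instance has infinitely many solutions. -/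
open List

theorem append_suffix_append {S : Type*} {p x : List S} (h : p <:+ x) (w : List S) :
    p ++ w <:+ x ++ w := by
  obtain ⟨r, rfl⟩ := h
  exact ⟨r, by simp⟩

theorem suffix_append_iff {S : Type*} {τ x w : List S} :
    τ <:+ x ++ w ↔ τ <:+ w ∨ ∃ p, τ = p ++ w ∧ p <:+ x := by
  constructor
  · rintro ⟨r, hr⟩
    rcases append_eq_append_iff.1 hr with ⟨m, rfl, rfl⟩ | ⟨m, rfl, rfl⟩
    · exact Or.inr ⟨m, rfl, suffix_append r m⟩
    · exact Or.inl (suffix_append m τ)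
  · rintro (h | ⟨p, rfl, hp⟩)
    · exact h.trans (suffix_append x w)
    · exact append_suffix_append hp w

/-- If `c ++ d` embeds in `e ++ f` while `d` does not embed in `f`, and `t` is a shortest
suffix with `d <+ t ++ f`, then `c ++ t` embeds in `e`. -/
theorem append_margin_sublist {G : Type*} {c d e f t E : List G}
    (h : c ++ d <+ e ++ f) (hred : ¬ d <+ f) (he : e <:+ E) (ht : t <:+ E)
    (hmin : ∀ s : List G, s <:+ E → d <+ s ++ f → t.length ≤ s.length) :
    c ++ t <+ e := by
  obtain ⟨r, s, hrs, hc, hd⟩ := append_sublist_iff.1 h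
  rcases append_eq_append_iff.1 hrs with ⟨m, rfl, rfl⟩ | ⟨m, rfl, rfl⟩
  · exact absurd (hd.trans (sublist_append_right _ _)) hred
  · have hm : m <:+ E := (suffix_append r m).trans he
    exact hc.append (suffix_of_suffix_length_le ht hm (hmin m hm hd)).sublist

theorem app_append_sublist_of_margin {S G : Type*} {u v : S → List G} {p w : List S}
    {t c : List G} (hp : app u p ++ t <+ c ++ app v p) (hw : app u w <+ t ++ app v w) :
    app u (p ++ w) <+ c ++ app v (p ++ w) := by
  rw [app_append, app_append, ← append_assoc]
  refine (hw.append_left (app u p)).trans ?_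
  rw [← append_assoc]
  exact hp.append_right _

theorem SynCongr.replicate_mem_iff {S : Type*} {L : Set (List S)} {y z : List S}
    (h : SynCongr L (y ++ z) z) (p : List S) (k : ℕ) :
    p ++ ((replicate k y).flatten ++ z) ∈ L ↔ p ++ z ∈ L := by
  induction k generalizing p with
  | zero => simp
  | succ k ih =>
    have h₁ := ih (p ++ y)
    have h₂ := h p []
    simp only [append_nil, append_assoc] at h₁ h₂
    simpa [replicate_succ, append_assoc] using h₁.trans h₂

theorem IsSolution.iterate_of_margin {S G : Type*} {u v : S → List G}
    {R R' : Set (List S)} {x y z : List S} (hsol : IsSolution u v R R' (x ++ (y ++ z)))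
    (hR : SynCongr R (y ++ z) z) (hR' : SynCongr R' (y ++ z) z)
    (hred₁ : ¬ app u (y ++ z) <+ app v (y ++ z)) (hred₂ : ¬ app u z <+ app v z)
    {ta tb : List G} (htaSuf : ta <:+ app v x)
    (htaEmb : app u (y ++ z) <+ ta ++ app v (y ++ z))
    (htaMin : ∀ t : List G, t <:+ app v x →
      app u (y ++ z) <+ t ++ app v (y ++ z) → ta.length ≤ t.length)
    (htbSuf : tb <:+ app v (x ++ y))
    (htbEmb : app u z <+ tb ++ app v z)
    (htbMin : ∀ t : List G, t <:+ app v (x ++ y) →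
      app u z <+ t ++ app v z → tb.length ≤ t.length)
    (htt : ta <+ tb) (k : ℕ) :
    IsSolution u v R R' (x ++ ((replicate (k + 1) y).flatten ++ z)) := by
  obtain ⟨hmem, hemb, hsuf⟩ := hsol
  have hstep : app u y ++ ta <+ ta ++ app v y := by
    refine (htt.append_left _).trans (append_margin_sublist (f := app v z) ?_ hred₂ ?_
      htbSuf htbMin)
    · simpa [app_append] using htaEmb
    · obtain ⟨r, hr⟩ := htaSuf
      exact ⟨r, by rw [app_append, ← hr, append_assoc]⟩
  have hpow (j : ℕ) : app u ((replicate (j + 1) y).flatten ++ z) <+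
      ta ++ app v ((replicate (j + 1) y).flatten ++ z) := by
    induction j with
    | zero => simpa using htaEmb
    | succ j ih =>
      rw [replicate_succ, flatten_cons, append_assoc]
      exact app_append_sublist_of_margin hstep ih
  have hsuffix_app {p q : List S} (h : p <:+ q) : app v p <:+ app v q := by
    obtain ⟨r, rfl⟩ := h
    exact ⟨app v r, (app_append v r p).symm⟩
  have hx {p : List S} (hp : p <:+ x)
      (hblue : app u (p ++ (y ++ z)) <+ app v (p ++ (y ++ z))) :
      app u p ++ ta <+ app v p := by
    rw [app_append u p, app_append v p] at hblue
    exact append_margin_sublist hblue hred₁ (hsuffix_app hp) htaSuf htaMin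
  have hy {p : List S} (hp : p <:+ y) (hblue : app u (p ++ z) <+ app v (p ++ z)) :
      app u p ++ tb <+ app v p := by
    rw [app_append u p, app_append v p] at hblue
    exact append_margin_sublist hblue hred₂
      (hsuffix_app (hp.trans (suffix_append x y))) htbSuf htbMin
  have hinner (j : ℕ) (τ : List S) (hτ : τ <:+ (replicate j y).flatten ++ z)
      (hτR : τ ∈ R') : app u τ <+ app v τ := by
    induction j generalizing τ with
    | zero =>
      refine hsuf τ (IsSuffix.trans ?_ ((suffix_append y z).trans (suffix_append x _))) hτR
      simpa using hτ
    | succ j ih =>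
      rw [replicate_succ, flatten_cons, append_assoc, suffix_append_iff] at hτ
      rcases hτ with hτ | ⟨p, rfl, hp⟩
      · exact ih τ hτ hτR
      · have hpz : p ++ z <:+ x ++ (y ++ z) :=
          (append_suffix_append (hp.trans (suffix_append x y)) z).trans (by simp)
        have hpb := hy hp (hsuf _ hpz ((hR'.replicate_mem_iff p j).1 hτR))
        cases j with
        | zero => simpa using app_append_sublist_of_margin (c := []) hpb htbEmb
        | succ j =>
          exact app_append_sublist_of_margin (c := [])
            ((htt.append_left _).trans hpb) (hpow j)
  refine ⟨?_, ?_, ?_⟩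
  · have := hR x []
    simp only [append_nil] at this
    exact (hR.replicate_mem_iff x (k + 1)).2 (this.1 hmem)
  · exact app_append_sublist_of_margin (c := []) (hx suffix_rfl hemb) (hpow k)
  · intro τ hτ hτR
    rw [suffix_append_iff] at hτ
    rcases hτ with hτ | ⟨p, rfl, hp⟩
    · exact hinner (k + 1) τ hτ hτR
    · have hpR : p ++ (y ++ z) ∈ R' := by
        have := hR' p []
        simp only [append_nil] at this
        exact this.2 ((hR'.replicate_mem_iff p (k + 1)).1 hτR)
      have hps := append_suffix_append hp (y ++ z)
      exact app_append_sublist_of_margin (c := []) (hx hp (hsuf _ hps hpR)) (hpow k)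

/-- Iteration lemma for red indices: if `a < b` are congruent red indices with
left margins `t_a ⊑ t_b`, then for every `k ≥ 1`,
`σ[0,a)·(σ[a,b))^k·σ[b,N)` is a solution; in particular the instance has
infinitely many solutions. -/
theorem iteration_lemma_red {S G : Type*} (u v : S → List G) (R R' : Set (List S))
    (σ : List S) (hsol : IsSolution u v R R' σ)
    (a b : ℕ) (hab : a < b) (hbN : b ≤ σ.length)
    (hcongR : SynCongr R (σ.drop a) (σ.drop b))
    (hcongR' : SynCongr R' (σ.drop a) (σ.drop b))
    (hreda : ¬ (app u (σ.drop a)) <+ (app v (σ.drop a)))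
    (hredb : ¬ (app u (σ.drop b)) <+ (app v (σ.drop b)))
    (ta tb : List G)
    (htaSuf : ta <:+ app v (σ.take a))
    (htaEmb : (app u (σ.drop a)) <+ (ta ++ app v (σ.drop a)))
    (htaMin : ∀ t : List G, t <:+ app v (σ.take a) →
      (app u (σ.drop a)) <+ (t ++ app v (σ.drop a)) → ta.length ≤ t.length)
    (htbSuf : tb <:+ app v (σ.take b))
    (htbEmb : (app u (σ.drop b)) <+ (tb ++ app v (σ.drop b)))
    (htbMin : ∀ t : List G, t <:+ app v (σ.take b) →
      (app u (σ.drop b)) <+ (t ++ app v (σ.drop b)) → tb.length ≤ t.length)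
    (htt : ta <+ tb) :
    (∀ k : ℕ, 1 ≤ k →
      IsSolution u v R R'
        (σ.take a ++ (List.replicate k ((σ.drop a).take (b - a))).flatten ++ σ.drop b)) ∧
    (∀ M : ℕ, ∃ σ' : List S, IsSolution u v R R' σ' ∧ M < σ'.length) := by
  obtain ⟨x, y, z, rfl, hx, hxy⟩ : ∃ x y z : List S, σ = x ++ (y ++ z) ∧
      x.length = a ∧ (x ++ y).length = b := by
    refine ⟨σ.take a, (σ.drop a).take (b - a), (σ.drop a).drop (b - a), ?_, ?_, ?_⟩
    · simp
    · simp; omega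
    · simp; omega
  have hda : (x ++ (y ++ z)).drop a = y ++ z := drop_left' hx
  have hta : (x ++ (y ++ z)).take a = x := take_left' hx
  have hdb : (x ++ (y ++ z)).drop b = z := by
    rw [← append_assoc]; exact drop_left' hxy
  have htb : (x ++ (y ++ z)).take b = x ++ y := by
    rw [← append_assoc]; exact take_left' hxy
  have hy : y.length = b - a := by simp at hxy; omega
  have hmid : (y ++ z).take (b - a) = y := take_left' hy
  rw [hda, hdb] at hcongR hcongR'
  rw [hda] at hreda htaEmb
  rw [hdb] at hredb htbEmb
  simp only [hta, hda] at htaSuf htaMin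
  simp only [htb, hdb] at htbSuf htbMin
  have key := hsol.iterate_of_margin hcongR hcongR' hreda hredb htaSuf htaEmb htaMin
    htbSuf htbEmb htbMin htt
  rw [hda, hdb, hta, hmid]
  refine ⟨fun k hk => ?_, fun M => ⟨_, key M, ?_⟩⟩
  · obtain ⟨j, rfl⟩ := Nat.exists_eq_add_of_le' hk
    rw [append_assoc]
    exact key j
  · have : M + 1 ≤ (M + 1) * y.length := Nat.le_mul_of_pos_right _ (by omega)
    simp only [length_append, length_flatten, map_replicate, sum_replicate, smul_eq_mul]
    omega
end

section
/- Let σ be a solution of the PEP^partial_codir instance (u, v, R, R'), of length N. If a < b are two blue indices in [0,N], with margins s_a and s_b, then s_a is a prefix of v(σ[a,b))·s_b. -/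
open List

/-- If `a < b` are blue indices with right margins `s_a`, `s_b`, then `s_a` is a
prefix of `v(σ[a,b))·s_b`. -/
theorem margin_prefix {S G : Type*} (u v : S → List G) (R R' : Set (List S))
    (σ : List S) (hsol : IsSolution u v R R' σ)
    (a b : ℕ) (hab : a < b) (hbN : b ≤ σ.length)
    (sa sb wa wb : List G)
    (hvaPre : app v (σ.drop a) = sa ++ wa)
    (huaEmb : (app u (σ.drop a)) <+ wa)
    (hsaMax : ∀ s w : List G, app v (σ.drop a) = s ++ w →
      (app u (σ.drop a)) <+ w → s.length ≤ sa.length)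
    (hvbPre : app v (σ.drop b) = sb ++ wb)
    (hubEmb : (app u (σ.drop b)) <+ wb)
    (hsbMax : ∀ s w : List G, app v (σ.drop b) = s ++ w →
      (app u (σ.drop b)) <+ w → s.length ≤ sb.length) :
    sa <+: (app v ((σ.drop a).take (b - a)) ++ sb) := by
  have hdrop : σ.drop a = (σ.drop a).take (b - a) ++ σ.drop b := by
    conv_lhs => rw [← take_append_drop (b - a) (σ.drop a)]
    rw [drop_drop, Nat.add_sub_cancel' hab.le]
  have hsplit (f : S → List G) :
      app f (σ.drop a) = app f ((σ.drop a).take (b - a)) ++ app f (σ.drop b) := by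
    rw [← app_append, ← hdrop]
  have hsb : app v ((σ.drop a).take (b - a)) ++ sb <+: app v (σ.drop a) :=
    ⟨wb, by rw [hsplit v, hvbPre, append_assoc]⟩
  rcases prefix_or_prefix_of_prefix ⟨wa, hvaPre.symm⟩ hsb with h | ⟨x, rfl⟩
  · exact h
  · have hvb : app v (σ.drop b) = (sb ++ x) ++ wa := by
      rw [hsplit v] at hvaPre
      simpa only [append_assoc, append_cancel_left_eq] using hvaPre
    have hub : app u (σ.drop b) <+ wa := by
      refine Sublist.trans ?_ huaEmb
      rw [hsplit u]
      exact sublist_append_right _ _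
    have hlen := hsbMax _ _ hvb hub
    have hx : x = [] := by
      rw [length_append] at hlen
      exact length_eq_zero_iff.mp (by omega)
    rw [hx, append_nil]
end

section
/- Let u, v : Σ* → Γ* be morphisms with |v(a)| ≤ K for every letter a ∈ Σ, and let R, R' ⊆ Σ*. Suppose there is an equivalence relation ≈ on Σ* with at most m equivalence classes such that x ≈ y implies that x and y are syntactically congruent with respect to R and syntactically congruent with respect to R'. Suppose further that L ∈ ℕ is such that every K-controlled sequence of words over Γ of length greater than L is (m+1)-good. If the PEP^partial_codir instance (u, v, R, R') has a solution of length greater than 2L, then it has infinitely many solutions (for every M ∈ ℕ there is a solution of length greater than M). -/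
open List

section Margins

variable {G : Type*}

/-- `l` is the part of `B` left over, on the left, by the rightmost embedding of `A` into `B`. -/
def IsLeftMargin (A B l : List G) : Prop :=
  l ++ A <+ B ∧ ∀ C D : List G, C ++ A <+ D ++ B → C <+ D ++ l

/-- `r` is the part of `A` left over, on the left, by the rightmost embedding of `A` into `B`. -/
def IsRightMargin (A B r : List G) : Prop :=
  A <+ r ++ B ∧ ∀ C D : List G, C ++ A <+ D ++ B → C ++ r <+ D

/-- When `A` does not embed into `B`, an embedding of `C ++ A` into `D ++ B` sends more than `C`
into `D`. -/
theorem exists_append_sublist_of_not_sublist {A B C D : List G} (hAB : ¬ A <+ B)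
    (h : C ++ A <+ D ++ B) : ∃ p q : List G, p ≠ [] ∧ A = p ++ q ∧ C ++ p <+ D ∧ q <+ B := by
  obtain ⟨s, t, hst, hs, ht⟩ := sublist_append_iff.1 h
  rcases append_eq_append_iff.1 hst with ⟨w, rfl, rfl⟩ | ⟨w, rfl, rfl⟩
  · refine ⟨w, t, ?_, rfl, hs, ht⟩
    rintro rfl
    exact hAB (by simpa using ht)
  · exact absurd ((sublist_append_right w A).trans ht) hAB

theorem exists_isLeftMargin {A B : List G} (h : A <+ B) : ∃ l, IsLeftMargin A B l := by
  induction B with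
  | nil =>
    obtain rfl := sublist_nil.1 h
    exact ⟨[], by simp, fun C D hCD => by simpa using hCD⟩
  | cons b B ih =>
    by_cases hAB : A <+ B
    · obtain ⟨l, hl, hmax⟩ := ih hAB
      refine ⟨b :: l, hl.cons_cons b, fun C D hCD => ?_⟩
      simpa using hmax C (D ++ [b]) (by simpa using hCD)
    · refine ⟨[], by simpa using h, fun C D hCD => ?_⟩
      obtain ⟨p, q, hp, -, hpD, -⟩ :=
        exists_append_sublist_of_not_sublist (D := D ++ [b]) hAB (by simpa using hCD)
      obtain ⟨p, c, rfl⟩ := eq_nil_or_concat p |>.resolve_left hp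
      rw [concat_eq_append] at hpD
      obtain ⟨s, t, hst, hs, ht⟩ := sublist_append_iff.1 hpD
      have hC : C <+: s := by
        refine prefix_of_prefix_length_le (l₃ := C ++ (p ++ [c])) (prefix_append _ _)
          (hst ▸ prefix_append _ _) ?_
        have h₁ := congrArg length hst
        have h₂ := ht.length_le
        simp at h₁ h₂
        omega
      simpa using hC.sublist.trans hs

theorem exists_isRightMargin {A B : List G} (h : ¬ A <+ B) : ∃ r, IsRightMargin A B r := by
  induction A with
  | nil => exact absurd (nil_sublist B) h
  | cons a A ih =>
    by_cases hAB : A <+ B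
    · refine ⟨[a], hAB.cons_cons a, fun C D hCD => ?_⟩
      obtain ⟨p, q, hp, hpq, hpD, -⟩ := exists_append_sublist_of_not_sublist h hCD
      obtain ⟨c, p, rfl⟩ := exists_cons_of_ne_nil hp
      obtain ⟨rfl, -⟩ := cons.inj hpq
      exact ((prefix_append [a] p).sublist.append_left C).trans hpD
    · obtain ⟨r, hr, hmin⟩ := ih hAB
      refine ⟨a :: r, hr.cons_cons a, fun C D hCD => ?_⟩
      simpa using hmin (C ++ [a]) D (by simpa using hCD)

end Margins

theorem app_cons {S G : Type*} (u : S → List G) (a : S) (x : List S) :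
    app u (a :: x) = u a ++ app u x := by
  simp [app]

theorem SynCongr.append_left {S : Type*} {L : Set (List S)} {x y : List S}
    (h : SynCongr L x y) (w : List S) : SynCongr L (w ++ x) (w ++ y) := fun p q => by
  simpa using h (p ++ w) q

/-- The word `yⁿz`. -/
def pumped {S : Type*} (y z : List S) : ℕ → List S
  | 0 => z
  | n + 1 => y ++ pumped y z n

section Pumping

variable {S G : Type*} {u v : S → List G} {R R' : Set (List S)} {x y z : List S}

theorem le_length_pumped (hy : y ≠ []) (n : ℕ) : n ≤ (pumped y z n).length := by
  induction n with
  | zero => simp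
  | succ n ih =>
    have := length_pos_of_ne_nil hy
    simp only [pumped, length_append]
    omega

theorem SynCongr.pumped {L : Set (List S)} (h : SynCongr L z (y ++ z)) (n : ℕ) :
    SynCongr L z (pumped y z n) := by
  induction n with
  | zero => exact fun _ _ => Iff.rfl
  | succ n ih => exact fun p q => (h p q).trans (ih.append_left y p q)

theorem suffix_append_cases_s17 {τ a b : List S} (h : τ <:+ a ++ b) :
    τ <:+ b ∨ ∃ a', a' <:+ a ∧ τ = a' ++ b := by
  obtain ⟨w, hw⟩ := h
  rcases append_eq_append_iff.1 hw with ⟨c, rfl, rfl⟩ | ⟨c, rfl, rfl⟩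
  · exact Or.inr ⟨c, suffix_append _ _, rfl⟩
  · exact Or.inl (suffix_append _ _)

theorem suffix_pumped_cases {τ : List S} {n : ℕ} (h : τ <:+ pumped y z n) :
    τ <:+ z ∨ ∃ y' k, y' <:+ y ∧ τ = y' ++ pumped y z k := by
  induction n with
  | zero => exact Or.inl h
  | succ n ih =>
    rcases suffix_append_cases_s17 h with h | ⟨y', hy', rfl⟩
    · exact ih h
    · exact Or.inr ⟨y', n, hy', rfl⟩

theorem IsSolution.pump (hR : SynCongr R z (y ++ z)) (hR' : SynCongr R' z (y ++ z))
    (hz : ∀ w n, app u (w ++ z) <+ app v (w ++ z) →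
      app u (w ++ pumped y z n) <+ app v (w ++ pumped y z n))
    (hyz : ∀ w n, app u (w ++ (y ++ z)) <+ app v (w ++ (y ++ z)) →
      app u (w ++ pumped y z (n + 1)) <+ app v (w ++ pumped y z (n + 1)))
    (h : IsSolution u v R R' (x ++ (y ++ z))) (n : ℕ) :
    IsSolution u v R R' (x ++ pumped y z (n + 1)) := by
  have mem_iff {L : Set (List S)} (hL : SynCongr L z (y ++ z)) (w : List S) (k : ℕ) :
      w ++ z ∈ L ↔ w ++ pumped y z k ∈ L := by
    simpa using hL.pumped k w []
  obtain ⟨hxR, hx, hsuf⟩ := h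
  refine ⟨(mem_iff hR x _).1 ((mem_iff hR x 1).2 hxR), hyz x n hx, fun τ hτ hτR => ?_⟩
  rcases suffix_append_cases_s17 hτ with hτ | ⟨x', hx', rfl⟩
  · rcases suffix_pumped_cases hτ with hτ | ⟨y', k, hy', rfl⟩
    · exact hsuf τ (hτ.trans ⟨x ++ y, by simp⟩) hτR
    · refine hz y' k (hsuf _ ?_ ((mem_iff hR' y' k).2 hτR))
      obtain ⟨t, rfl⟩ := hy'
      exact ⟨x ++ t, by simp⟩
  · refine hyz x' n (hsuf _ ?_ ((mem_iff hR' x' 1).1 ((mem_iff hR' x' _).2 hτR)))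
    obtain ⟨t, rfl⟩ := hx'
    exact ⟨t, by simp⟩

theorem IsSolution.pump_of_isLeftMargin {l l' : List G}
    (hR : SynCongr R z (y ++ z)) (hR' : SynCongr R' z (y ++ z))
    (hl : IsLeftMargin (app u z) (app v z) l)
    (hl' : IsLeftMargin (app u (y ++ z)) (app v (y ++ z)) l') (hll : l <+ l')
    (h : IsSolution u v R R' (x ++ (y ++ z))) (n : ℕ) :
    IsSolution u v R R' (x ++ pumped y z (n + 1)) := by
  have step : l' ++ app u y <+ app v y ++ l :=
    hl.2 _ _ (by simpa [app_append] using hl'.1)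
  have next {k : ℕ} (hk : l ++ app u (pumped y z k) <+ app v (pumped y z k)) :
      l' ++ app u (pumped y z (k + 1)) <+ app v (pumped y z (k + 1)) := by
    have := (step.append_right (app u (pumped y z k))).trans
      (append_assoc (app v y) l _ ▸ hk.append_left (app v y))
    simpa [pumped, app_append] using this
  have key (k : ℕ) : l ++ app u (pumped y z k) <+ app v (pumped y z k) := by
    induction k with
    | zero => exact hl.1
    | succ k ih => exact (hll.append_right _).trans (next ih)
  refine h.pump hR hR' (fun w k hw => ?_) (fun w k hw => ?_) n
  · have hw' := hl.2 (app u w) (app v w) (by simpa [app_append] using hw)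
    rw [app_append, app_append]
    exact (hw'.append_right _).trans (by simpa using (key k).append_left (app v w))
  · have hw' := hl'.2 (app u w) (app v w) (by simpa only [app_append u w, app_append v w] using hw)
    rw [app_append, app_append]
    exact (hw'.append_right _).trans (by simpa using (next (key k)).append_left (app v w))

theorem IsSolution.pump_of_isRightMargin {r r' : List G}
    (hR : SynCongr R z (y ++ z)) (hR' : SynCongr R' z (y ++ z))
    (hr : IsRightMargin (app u z) (app v z) r)
    (hr' : IsRightMargin (app u (y ++ z)) (app v (y ++ z)) r') (hrr : r' <+ r)
    (h : IsSolution u v R R' (x ++ (y ++ z))) (n : ℕ) :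
    IsSolution u v R R' (x ++ pumped y z (n + 1)) := by
  have step : app u y ++ r <+ r' ++ app v y :=
    hr.2 _ _ (by simpa [app_append] using hr'.1)
  have next {k : ℕ} (hk : app u (pumped y z k) <+ r ++ app v (pumped y z k)) :
      app u (pumped y z (k + 1)) <+ r' ++ app v (pumped y z (k + 1)) := by
    have := (hk.append_left (app u y)).trans
      (by simpa using step.append_right (app v (pumped y z k)))
    simpa [pumped, app_append] using this
  have key (k : ℕ) : app u (pumped y z k) <+ r ++ app v (pumped y z k) := by
    induction k with
    | zero => exact hr.1
    | succ k ih => exact (next ih).trans (hrr.append_right _)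
  refine h.pump hR hR' (fun w k hw => ?_) (fun w k hw => ?_) n
  · have hw' := hr.2 (app u w) (app v w) (by simpa [app_append] using hw)
    rw [app_append, app_append]
    exact ((key k).append_left (app u w)).trans (by simpa using hw'.append_right _)
  · have hw' := hr'.2 (app u w) (app v w) (by simpa only [app_append u w, app_append v w] using hw)
    rw [app_append, app_append]
    exact ((next (key k)).append_left (app u w)).trans (by simpa using hw'.append_right _)

end Pumping

/-- Picking the members of a sequence of words that satisfy `P` yields a controlled sequence, in
which two members of the same colour are comparable. -/
theorem exists_lt_sublist_of_controlled {G : Type*} {K m L : ℕ}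
    (hL : ∀ (l : ℕ) (x : Fin l → List G), L < l →
      (∀ i : Fin l, (x i).length ≤ ((i : ℕ) + 1) * K) →
      ∃ g : Fin (m + 1) → Fin l, StrictMono g ∧
        ∀ i j : Fin (m + 1), i ≤ j → (x (g i)) <+ (x (g j)))
    (P : ℕ → Prop) [DecidablePred P] (N : ℕ) (hP : L < Nat.count P N)
    (w : ℕ → List G) (c : ℕ → Fin m)
    (zero : P 0 → (w 0).length ≤ K)
    (succ : ∀ i, i + 1 < N → P (i + 1) →
      (w (i + 1)).length ≤ (if P i then (w i).length else 0) + K) :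
    ∃ i j, i < j ∧ j < N ∧ P i ∧ P j ∧ c i = c j ∧ w i <+ w j := by
  have bound (i : ℕ) : i < N → P i → (w i).length ≤ (Nat.count P i + 1) * K := by
    induction i with
    | zero => simpa using fun _ => zero
    | succ i ih =>
      intro hi hPi
      have h := succ i hi hPi
      rw [Nat.count_succ]
      split_ifs at h ⊢ with hp
      · have := ih (by omega) hp
        linarith
      · linarith [Nat.zero_le (Nat.count P i * K)]
  have hcard {n : ℕ} (hn : n < Nat.count P N) (hf : {i | P i}.Finite) :
      n < hf.toFinset.card := hn.trans_le (Nat.count_le_card hf N)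
  have hlt {n : ℕ} (hn : n < Nat.count P N) : Nat.nth P n < N := Nat.nth_lt_of_lt_count hn
  obtain ⟨g, hg, hsub⟩ := hL (Nat.count P N) (fun i => w (Nat.nth P i)) hP fun i => by
    simpa only [Nat.count_nth (hcard i.2)] using
      bound _ (hlt i.2) (Nat.nth_mem _ (hcard i.2))
  obtain ⟨i, j, hij, hc⟩ := Fintype.exists_ne_map_eq_of_card_lt
    (fun i => c (Nat.nth P (g i))) (by simp)
  wlog hlt' : i < j generalizing i j
  · exact this j i hij.symm hc.symm (lt_of_le_of_ne (not_lt.1 hlt') hij.symm)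
  exact ⟨_, _, Nat.nth_lt_nth' (hg hlt') (hcard (g j).2), hlt (g j).2,
    Nat.nth_mem _ (hcard (g i).2), Nat.nth_mem _ (hcard (g j).2), hc, hsub i j hlt'.le⟩

theorem count_reflect_add_count_not (P : ℕ → Prop) [DecidablePred P] (N : ℕ) :
    Nat.count (fun i => P (N - 1 - i)) N + Nat.count (fun i => ¬ P i) N = N := by
  have h := Finset.sum_range_reflect (fun i => if P i then 1 else 0) N
  rw [Nat.count_eq_card_filter_range, Nat.count_eq_card_filter_range, Finset.card_filter, h,
    ← Finset.card_filter, Finset.card_filter_add_card_filter_not, Finset.card_range]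

theorem drop_eq_append_drop {S : Type*} (σ : List S) {i j : ℕ} (hij : i < j)
    (hj : j ≤ σ.length) : ∃ y, y ≠ [] ∧ σ.drop i = y ++ σ.drop j := by
  refine ⟨(σ.drop i).take (j - i), ?_, ?_⟩
  · rw [← length_pos_iff]
    simp
    omega
  · conv_lhs => rw [← take_append_drop (j - i) (σ.drop i)]
    rw [drop_drop, Nat.add_sub_cancel' hij.le]

/-- A long solution contains a factor `y` that can be pumped. -/
theorem exists_pumpable {S G : Type*} (u v : S → List G) (R R' : Set (List S))
    (K : ℕ) (hK : ∀ a : S, (v a).length ≤ K) (m : ℕ) (f : List S → Fin m)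
    (hcong : ∀ x y : List S, f x = f y → SynCongr R x y ∧ SynCongr R' x y)
    (L : ℕ)
    (hL : ∀ (l : ℕ) (x : Fin l → List G), L < l →
      (∀ i : Fin l, (x i).length ≤ ((i : ℕ) + 1) * K) →
      ∃ g : Fin (m + 1) → Fin l, StrictMono g ∧
        ∀ i j : Fin (m + 1), i ≤ j → (x (g i)) <+ (x (g j)))
    (σ : List S) (hσ : IsSolution u v R R' σ) (hlong : 2 * L < σ.length) :
    ∃ x y z : List S, y ≠ [] ∧ ∀ n, IsSolution u v R R' (x ++ pumped y z (n + 1)) := by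
  classical
  let P (i : ℕ) : Prop := app u (σ.drop i) <+ app v (σ.drop i)
  have hcount := count_reflect_add_count_not P (σ.length + 1)
  rw [Nat.add_sub_cancel] at hcount
  rcases Nat.lt_or_ge L (Nat.count (fun i => P (σ.length - i)) (σ.length + 1)) with hb | hb
  · choose! w hw using fun (i : ℕ) (hi : P (σ.length - i)) => exists_isLeftMargin hi
    obtain ⟨i, j, hij, hj, hi, hPj, hc, hsub⟩ := exists_lt_sublist_of_controlled hL
      (fun i => P (σ.length - i)) (σ.length + 1) hb w (fun i => f (σ.drop (σ.length - i)))
      (fun h => by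
        have := (hw 0 h).1.length_le
        simp [app] at this
        simp [this])
      (fun i hi hPi => by
        have hd : σ.drop (σ.length - (i + 1)) =
            σ[σ.length - (i + 1)]'(by omega) :: σ.drop (σ.length - i) := by
          rw [drop_eq_getElem_cons (by omega)]
          congr 2
          omega
        have hwi := (hw (i + 1) hPi).1
        generalize σ[σ.length - (i + 1)]'(by omega) = a at hd
        rw [hd, app_cons, app_cons, ← append_assoc] at hwi
        have ha := hK a
        split_ifs with hp
        · have := ((hw i hp).2 _ _ hwi).length_le
          simp at this
          omega
        · obtain ⟨p, q, -, -, hp, -⟩ := exists_append_sublist_of_not_sublist hp hwi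
          have := hp.length_le
          simp at this
          omega)
    obtain ⟨y, hy, hdrop⟩ := drop_eq_append_drop σ (i := σ.length - j) (j := σ.length - i)
      (by omega) (by omega)
    have hcc := hcong _ _ hc
    have hwj := hw j hPj
    rw [hdrop] at hcc hwj
    refine ⟨σ.take (σ.length - j), y, σ.drop (σ.length - i), hy,
      IsSolution.pump_of_isLeftMargin hcc.1 hcc.2 (hw i hi) hwj hsub ?_⟩
    rwa [← hdrop, take_append_drop]
  · choose! w hw using fun (i : ℕ) (hi : ¬ P i) => exists_isRightMargin hi
    obtain ⟨i, j, hij, hj, hi, hPj, hc, hsub⟩ := exists_lt_sublist_of_controlled hL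
      (fun i => ¬ P i) (σ.length + 1) (by omega) w (fun i => f (σ.drop i))
      (fun h => absurd hσ.2.1 h)
      (fun i hi hPi => by
        have hd := drop_eq_getElem_cons (l := σ) (i := i) (by omega)
        have hwi := hw (i + 1) hPi
        generalize σ[i]'(by omega) = a at hd
        have ha := hK a
        split_ifs with hp
        · have h : app u (σ.drop i) <+ app v (σ.drop i) := hp
          rw [hd, app_cons, app_cons] at h
          have := (hwi.2 _ _ h).length_le
          simp at this
          omega
        · have h := (hw i hp).1
          rw [hd, app_cons, app_cons, ← append_assoc] at h
          have := (hwi.2 _ _ h).length_le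
          simp at this
          omega)
    obtain ⟨y, hy, hdrop⟩ := drop_eq_append_drop σ hij (by omega)
    have hcc := hcong _ _ hc.symm
    have hwi := hw i hi
    rw [hdrop] at hcc hwi
    refine ⟨σ.take i, y, σ.drop j, hy,
      IsSolution.pump_of_isRightMargin hcc.1 hcc.2 (hw j hPj) hwi hsub ?_⟩
    rwa [← hdrop, take_append_drop]

/-- Theorem (long solutions): if `v` has expansion factor at most `K`, the
syntactic congruences of `R` and `R'` are jointly refined by an equivalence with
at most `m` classes, and `L` bounds the length of `(m+1)`-bad `K`-controlled
sequences over `Γ`, then a solution of length `> 2L` yields infinitely many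
solutions. -/
theorem long_solution_theorem {S G : Type*} (u v : S → List G) (R R' : Set (List S))
    (K : ℕ) (hK : ∀ a : S, (v a).length ≤ K)
    (m : ℕ) (E : List S → List S → Prop) (hE : Equivalence E)
    (f : List S → Fin m) (hf : ∀ x y : List S, E x y ↔ f x = f y)
    (hcong : ∀ x y : List S, E x y → SynCongr R x y ∧ SynCongr R' x y)
    (L : ℕ)
    (hL : ∀ (l : ℕ) (x : Fin l → List G), L < l →
      (∀ i : Fin l, (x i).length ≤ ((i : ℕ) + 1) * K) →
      ∃ g : Fin (m + 1) → Fin l, StrictMono g ∧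
        ∀ i j : Fin (m + 1), i ≤ j → (x (g i)) <+ (x (g j)))
    (hlong : ∃ σ : List S, IsSolution u v R R' σ ∧ 2 * L < σ.length) :
    ∀ M : ℕ, ∃ σ' : List S, IsSolution u v R R' σ' ∧ M < σ'.length := by
  intro M
  obtain ⟨σ, hσ, hlen⟩ := hlong
  obtain ⟨x, y, z, hy, hsol⟩ := exists_pumpable u v R R' K hK m f
    (fun x y h => hcong x y ((hf x y).2 h)) L hL σ hσ hlen
  refine ⟨_, hsol M, ?_⟩
  have := le_length_pumped (z := z) hy (M + 1)
  rw [length_append]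
  omega
end

section
/- Let u, v : Σ* → Γ* be morphisms (a PCP instance). Let Σ' = Σ ∪ {1, 2} (two fresh letters) and Γ' = Γ ∪ {#} (a fresh letter), and let u', v' : Σ'* → Γ'* be the morphisms extending u and v with u'(1) = v'(2) = ε and u'(2) = v'(1) = #. Let R = { 12σ : σ ∈ Σ*, σ ≠ ε } and R' = { τ2τ' : τ, τ' ∈ Σ*, |u(ττ')| ≠ |v(ττ')| }. Then the PCP instance has a solution (i.e., there exists x ∈ Σ*, x ≠ ε, with u(x) = v(x)) if and only if the PEP^partial_codir instance (u', v', R, R') has a solution (i.e., there exists σ ∈ R with u'(σ) ⊑ v'(σ) and u'(τ) ⊑ v'(τ) for every suffix τ of σ with τ ∈ R'). -/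
open List

/-- The extended alphabet `Σ' = Σ ∪ {1, 2}`: `Sum.inr false` is the letter `1`,
`Sum.inr true` is the letter `2`. The extended target alphabet `Γ' = Γ ∪ {#}`
is `Option G`, with `none` playing the role of `#`. -/
def extendU {S G : Type*} (u : S → List G) : S ⊕ Bool → List (Option G)
  | Sum.inl a => (u a).map some
  | Sum.inr false => []          -- u'(1) = ε
  | Sum.inr true => [none]       -- u'(2) = #

def extendV {S G : Type*} (v : S → List G) : S ⊕ Bool → List (Option G)
  | Sum.inl a => (v a).map some
  | Sum.inr false => [none]      -- v'(1) = #
  | Sum.inr true => []           -- v'(2) = ε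

/-- `R = 12Σ⁺`. -/
def Rpcp (S : Type*) : Set (List (S ⊕ Bool)) :=
  {w | ∃ x : List S, x ≠ [] ∧
    w = Sum.inr false :: Sum.inr true :: x.map Sum.inl}

/-- `R' = { τ2τ' : τ, τ' ∈ Σ*, |u(ττ')| ≠ |v(ττ')| }`. -/
def Rpcp' {S G : Type*} (u v : S → List G) : Set (List (S ⊕ Bool)) :=
  {w | ∃ τ τ' : List S,
    w = τ.map Sum.inl ++ Sum.inr true :: τ'.map Sum.inl ∧
    (app u (τ ++ τ')).length ≠ (app v (τ ++ τ')).length}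

theorem app_extendU_map_inl {S G : Type*} (u : S → List G) (x : List S) :
    app (extendU u) (x.map Sum.inl) = (app u x).map some := by
  induction x with
  | nil => rfl
  | cons a x ih => simp_all [app, extendU]

theorem app_extendV_map_inl {S G : Type*} (v : S → List G) (x : List S) :
    app (extendV v) (x.map Sum.inl) = (app v x).map some := by
  induction x with
  | nil => rfl
  | cons a x ih => simp_all [app, extendV]

theorem two_cons_mem_Rpcp' {S G : Type*} (u v : S → List G) (x : List S) :
    Sum.inr true :: x.map Sum.inl ∈ Rpcp' u v ↔
      (app u x).length ≠ (app v x).length := by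
  constructor
  · rintro ⟨τ, τ', h, hne⟩
    cases τ with
    | cons a τ => simp at h
    | nil =>
      have hx : x = τ' := by
        simpa [Sum.inl_injective.list_map.eq_iff] using h
      simpa [hx] using hne
  · intro hne
    exact ⟨[], x, by simp, by simpa using hne⟩

theorem one_notMem_of_mem_Rpcp' {S G : Type*} {u v : S → List G} {w : List (S ⊕ Bool)}
    (h : w ∈ Rpcp' u v) : Sum.inr false ∉ w := by
  obtain ⟨τ, τ', rfl, -⟩ := h
  simp

theorem two_mem_of_mem_Rpcp' {S G : Type*} {u v : S → List G} {w : List (S ⊕ Bool)}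
    (h : w ∈ Rpcp' u v) : Sum.inr true ∈ w := by
  obtain ⟨τ, τ', rfl, -⟩ := h
  simp

/-- The PCP instance `(u, v)` has a solution iff the PEP^partial_codir instance
`(u', v', 12Σ⁺, R')` has a solution. -/
theorem pcp_reduces_to_pep_partial_codir {S G : Type*} (u v : S → List G) :
    (∃ x : List S, x ≠ [] ∧ app u x = app v x) ↔
    (∃ σ : List (S ⊕ Bool),
      IsSolution (extendU u) (extendV v) (Rpcp S) (Rpcp' u v) σ) := by
  constructor
  · rintro ⟨x, hx, h⟩
    refine ⟨_, ⟨x, hx, rfl⟩, ?_, fun τ hτ hR => ?_⟩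
    · simp [app_cons, app_extendU_map_inl, app_extendV_map_inl, extendU, extendV, h]
    · rcases List.suffix_cons_iff.1 hτ with rfl | hτ
      · exact absurd (by simp) (one_notMem_of_mem_Rpcp' hR)
      rcases List.suffix_cons_iff.1 hτ with rfl | hτ
      · exact absurd (by rw [h]) ((two_cons_mem_Rpcp' u v x).1 hR)
      · simpa using hτ.subset (two_mem_of_mem_Rpcp' hR)
  · rintro ⟨_, ⟨x, hx, rfl⟩, hsub, hsuf⟩
    refine ⟨x, hx, ?_⟩
    have hlen : (app u x).length = (app v x).length := by
      by_contra hne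
      have hs := hsuf _ (List.suffix_cons _ _) ((two_cons_mem_Rpcp' u v x).2 hne)
      simp only [app_cons, app_extendU_map_inl, app_extendV_map_inl, extendU, extendV] at hs
      have : none ∈ (app v x).map some := hs.subset (by simp)
      simp at this
    simp only [app_cons, app_extendU_map_inl, app_extendV_map_inl, extendU, extendV,
      List.nil_append, List.singleton_append, List.cons_sublist_cons] at hsub
    exact (Option.some_injective G).list_map (hsub.eq_of_length (by simp [hlen]))
end
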